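/- Let G = C_6 be the 6-cycle. Then reg(S/J_G) = 4 and reg(S/J_G^t) = 2t + 2 for all t ≥ 2, where J_G is the binomial edge ideal of G. -/

import Mathlib

open MvPolynomial

/-- The binomial edge ideal of a simple graph `G`, in the polynomial ring with two
variables `x_v = X (Sum.inl v)` and `y_v = X (Sum.inr v)` for each vertex `v`. -/
noncomputable def binomialEdgeIdeal {V : Type*} (K : Type*) [Field K] (G : SimpleGraph V) :
    Ideal (MvPolynomial (V ⊕ V) K) :=
  Ideal.span {f | ∃ u v : V, G.Adj u v ∧
    f = X (Sum.inl u) * X (Sum.inr v) - X (Sum.inl v) * X (Sum.inr u)}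

/-- A finite graded free resolution of `S ⧸ J`: homological data recorded by ranks `rk i`,
twists `tw i` (the `r`-th summand of the `i`-th term is `S(- tw i r)`), matrices `mat i`
of the differentials `F (i+1) → F i` and the augmentation `F 0 → S ⧸ J`, with homogeneous
entries of the appropriate degrees, which is exact. -/
structure GradedFreeResolution {σ K : Type*} [Field K] (J : Ideal (MvPolynomial σ K)) :
    Type _ where
  len : ℕ
  rk : ℕ → ℕ
  tw : (i : ℕ) → Fin (rk i) → ℕ
  mat : (i : ℕ) → Fin (rk i) → Fin (rk (i + 1)) → MvPolynomial σ K
  aug : Fin (rk 0) → MvPolynomial σ K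
  finite : ∀ i : ℕ, len < i → rk i = 0
  aug_homog : ∀ r : Fin (rk 0), (aug r).IsHomogeneous (tw 0 r)
  mat_homog : ∀ (i : ℕ) (r : Fin (rk i)) (c : Fin (rk (i + 1))),
    if tw i r ≤ tw (i + 1) c then (mat i r c).IsHomogeneous (tw (i + 1) c - tw i r)
    else mat i r c = 0
  aug_surj : ∀ s : MvPolynomial σ K, ∃ v : Fin (rk 0) → MvPolynomial σ K,
    s - ∑ r, aug r * v r ∈ J
  exact_zero : ∀ v : Fin (rk 0) → MvPolynomial σ K,
    (∑ r, aug r * v r ∈ J) ↔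
      ∃ w : Fin (rk 1) → MvPolynomial σ K, ∀ r, v r = ∑ c, mat 0 r c * w c
  exact_succ : ∀ (i : ℕ) (v : Fin (rk (i + 1)) → MvPolynomial σ K),
    (∀ r : Fin (rk i), ∑ c, mat i r c * v c = 0) ↔
      ∃ w : Fin (rk (i + 2)) → MvPolynomial σ K, ∀ c, v c = ∑ e, mat (i + 1) c e * w e

/-- The Castelnuovo–Mumford regularity of `S ⧸ J`, defined as the least `m` such that some
graded free resolution of `S ⧸ J` has all its `i`-th syzygies in degrees at most `m + i`
(the minimal free resolution realizes this minimum, which is `max { j - i : β_{i,i+j} ≠ 0 }`). -/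
noncomputable def quotRegularity {σ : Type*} (K : Type*) [Field K]
    (J : Ideal (MvPolynomial σ K)) : ℕ :=
  sInf {m : ℕ | ∃ F : GradedFreeResolution (K := K) J,
    ∀ (i : ℕ) (r : Fin (F.rk i)), F.tw i r ≤ m + i}

namespace C6
universe u
set_option linter.unusedSectionVars false
set_option linter.unusedVariables false

/-- A ring with a loose `ℤ`-grading with component maps. -/
class ZG (S : Type u) [CommRing S] where
  hd : ℤ → AddSubgroup S
  cmp : ℤ → S →+ S
  hd_mul : ∀ {i j a b}, a ∈ hd i → b ∈ hd j → a * b ∈ hd (i + j)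
  hd_one : (1 : S) ∈ hd 0
  cmp_mem : ∀ d p, cmp d p ∈ hd d
  cmp_self : ∀ {d p}, p ∈ hd d → cmp d p = p
  cmp_mul : ∀ {k f}, f ∈ hd k → ∀ d a, cmp d (f * a) = f * cmp (d - k) a

open ZG

/-- Graded modules (loose). -/
structure GM (S : Type u) [CommRing S] [ZG S] where
  M : Type u
  [acg : AddCommGroup M]
  [mod : Module S M]
  gr : ℤ → AddSubgroup M
  smul_mem : ∀ {a b p m}, p ∈ hd (S := S) a → m ∈ gr b → p • m ∈ gr (a + b)

attribute [instance] GM.acg GM.mod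

variable {S : Type u} [CommRing S] [ZG S]

/-- degree pieces of a free module with twists -/
def fgr {ι : Type} (tw : ι → ℤ) (d : ℤ) : AddSubgroup (ι → S) where
  carrier := {v | ∀ i, v i ∈ hd (d - tw i)}
  zero_mem' := fun i => zero_mem _
  add_mem' := fun h h' i => add_mem (h i) (h' i)
  neg_mem' := fun h i => neg_mem (h i)

theorem fgr_smul {ι : Type} (tw : ι → ℤ) {a b : ℤ} {p : S} {m : ι → S} (hp : p ∈ hd a)
    (hm : m ∈ fgr tw b) : p • m ∈ fgr tw (a + b) := by
  intro i
  have := hd_mul hp (hm i)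
  rw [← add_sub_assoc] at this
  exact this

abbrev FreeG (ι : Type) (tw : ι → ℤ) : GM S where
  M := ι → S
  gr d := fgr tw d
  smul_mem := fun hp hm => fgr_smul tw hp hm

abbrev KerG {ι : Type} (tw : ι → ℤ) (N : Submodule S (ι → S)) : GM S where
  M := N
  gr d := (fgr tw d).comap N.subtype.toAddMonoidHom
  smul_mem := fun hp hm => fgr_smul tw hp hm

abbrev SubG (X : GM S) (N : Submodule S X.M) : GM S where
  M := N
  gr d := (X.gr d).comap N.subtype.toAddMonoidHom
  smul_mem := by
    intro a b p m hp hm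
    exact X.smul_mem hp hm

abbrev shift (k : ℤ) (X : GM S) : GM S where
  M := X.M
  gr d := X.gr (d - k)
  smul_mem := by
    intro a b p m hp hm
    rw [add_sub_assoc]
    exact X.smul_mem hp hm

abbrev ProdG (X Y : GM S) : GM S where
  M := X.M × Y.M
  gr d := (X.gr d).prod (Y.gr d)
  smul_mem := by
    intro a b p m hp hm
    exact ⟨X.smul_mem hp hm.1, Y.smul_mem hp hm.2⟩

/-- linear combination map from the free module -/
def lcm {ι : Type} [Fintype ι] {M : Type u} [AddCommGroup M] [Module S M] (g : ι → M) :
    (ι → S) →ₗ[S] M :=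
  Fintype.linearCombination S g

theorem lcm_apply {ι : Type} [Fintype ι] {M : Type u} [AddCommGroup M] [Module S M]
    (g : ι → M) (v : ι → S) : lcm g v = ∑ i, v i • g i := rfl

def Res : ℕ → GM S → ℤ → ℤ → Prop
  | 0, X, _, _ => Subsingleton X.M
  | n + 1, X, lo, hi => ∃ (ι : Type) (_ : Fintype ι) (tw : ι → ℤ) (g : ι → X.M),
      (∀ i, lo ≤ tw i ∧ tw i ≤ hi) ∧ (∀ i, g i ∈ X.gr (tw i)) ∧
      (∀ d, ∀ x ∈ X.gr d, ∃ v ∈ fgr (S := S) tw d, lcm g v = x) ∧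
      Function.Surjective (lcm (S := S) g) ∧
      Res n (KerG tw (LinearMap.ker (lcm (S := S) g))) lo (hi + 1)

theorem Res.mono {n : ℕ} {X : GM S} {lo hi lo' hi' : ℤ} (h : Res n X lo hi) (h1 : lo' ≤ lo)
    (h2 : hi ≤ hi') : Res n X lo' hi' := by
  induction n generalizing X hi hi' with
  | zero => exact h
  | succ n ih =>
    obtain ⟨ι, _, tw, g, a, b, c, d, e⟩ := h
    exact ⟨ι, _, tw, g, fun i => ⟨h1.trans (a i).1, (a i).2.trans h2⟩, b, c, d, ih e (by omega)⟩

theorem Res.succ {n : ℕ} {X : GM S} {lo hi : ℤ} (h : Res n X lo hi) : Res (n + 1) X lo hi := by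
  induction n generalizing X hi with
  | zero =>
    have h : Subsingleton X.M := h
    refine ⟨Empty, inferInstance, Empty.elim, Empty.elim, fun i => i.elim, fun i => i.elim, ?_, ?_, ?_⟩
    · intro d x _
      exact ⟨0, zero_mem _, Subsingleton.elim _ _⟩
    · intro x
      exact ⟨0, Subsingleton.elim _ _⟩
    · show Subsingleton _
      constructor
      rintro ⟨x, _⟩ ⟨y, _⟩
      apply Subtype.ext
      funext i
      exact i.elim
  | succ n ih =>
    obtain ⟨ι, _, tw, g, a, b, c, d, e⟩ := h
    exact ⟨ι, _, tw, g, a, b, c, d, ih e⟩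

theorem Res.mono_n {n m : ℕ} {X : GM S} {lo hi : ℤ} (h : Res n X lo hi) (hnm : n ≤ m) :
    Res m X lo hi := by
  induction hnm with
  | refl => exact h
  | step _ ih => exact ih.succ

structure SES (A B C : GM S) where
  i : A.M →ₗ[S] B.M
  p : B.M →ₗ[S] C.M
  inj : Function.Injective i
  surj : Function.Surjective p
  exact : ∀ b, p b = 0 ↔ ∃ a, i a = b
  i_gr : ∀ d a, a ∈ A.gr d → i a ∈ B.gr d
  i_refl : ∀ d a, i a ∈ B.gr d → a ∈ A.gr d
  p_gr : ∀ d b, b ∈ B.gr d → p b ∈ C.gr d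
  p_lift : ∀ d, ∀ c ∈ C.gr d, ∃ b ∈ B.gr d, p b = c

def inlMap (ι κ : Type) : (ι → S) →ₗ[S] (ι ⊕ κ → S) where
  toFun v := Sum.elim v 0
  map_add' v w := by funext i; cases i <;> simp
  map_smul' v w := by funext i; cases i <;> simp

theorem Res.ext {n : ℕ} {A B C : GM S} (s : SES A B C) {lo hi : ℤ} (hA : Res n A lo hi)
    (hC : Res n C lo hi) : Res n B lo hi := by
  induction n generalizing A B C hi with
  | zero =>
    have h1 : Subsingleton A.M := hA
    have h2 : Subsingleton C.M := hC
    show Subsingleton B.M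
    have h0 : ∀ b : B.M, b = 0 := by
      intro b
      obtain ⟨a, rfl⟩ := (s.exact b).1 (Subsingleton.elim _ _)
      rw [Subsingleton.elim a 0, map_zero]
    exact ⟨fun x y => by rw [h0 x, h0 y]⟩
  | succ n ih =>
    obtain ⟨ι, _, tw, g, a1, a2, a3, a4, a5⟩ := hA
    obtain ⟨κ, _, tx, h, c1, c2, c3, c4, c5⟩ := hC
    choose l l1 l2 using fun k => s.p_lift _ _ (c2 k)
    have key : ∀ v : ι ⊕ κ → S, lcm (Sum.elim (fun i => s.i (g i)) l) v
        = s.i (lcm g (v ∘ Sum.inl)) + lcm l (v ∘ Sum.inr) := by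
      intro v
      simp [lcm_apply, Fintype.sum_sum_type]
    have kp : ∀ v : κ → S, s.p (lcm l v) = lcm h v := by
      intro v
      simp [lcm_apply, l2]
    have lgr : ∀ d, ∀ v ∈ fgr (S := S) tx d, lcm l v ∈ B.gr d := by
      intro d v hv
      rw [lcm_apply]
      refine sum_mem fun k _ => ?_
      have := B.smul_mem (hv k) (l1 k)
      rwa [sub_add_cancel] at this
    have pi0 : ∀ a, s.p (s.i a) = 0 := fun a => (s.exact _).2 ⟨a, rfl⟩
    refine ⟨ι ⊕ κ, inferInstance, Sum.elim tw tx, Sum.elim (fun i => s.i (g i)) l, ?_, ?_, ?_, ?_, ?_⟩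
    · rintro (i | i)
      · exact a1 i
      · exact c1 i
    · rintro (i | i)
      · exact s.i_gr _ _ (a2 i)
      · exact l1 i
    · intro d x hx
      obtain ⟨v, hv, hv'⟩ := c3 d _ (s.p_gr d x hx)
      obtain ⟨a, ha⟩ := (s.exact (x - lcm l v)).1 (by rw [map_sub, kp, hv', sub_self])
      have hag : a ∈ A.gr d := s.i_refl d a (by rw [ha]; exact sub_mem hx (lgr d v hv))
      obtain ⟨w, hw, hw'⟩ := a3 d a hag
      refine ⟨Sum.elim w v, ?_, ?_⟩
      · rintro (i | i)
        · exact hw i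
        · exact hv i
      · rw [key]
        simp only [Sum.elim_comp_inl, Sum.elim_comp_inr]
        rw [hw', ha, sub_add_cancel]
    · intro x
      obtain ⟨v, hv'⟩ := c4 (s.p x)
      obtain ⟨a, ha⟩ := (s.exact (x - lcm l v)).1 (by rw [map_sub, kp, hv', sub_self])
      obtain ⟨w, hw'⟩ := a4 a
      refine ⟨Sum.elim w v, ?_⟩
      rw [key]
      simp only [Sum.elim_comp_inl, Sum.elim_comp_inr]
      rw [hw', ha, sub_add_cancel]
    · have hi' : ∀ x ∈ LinearMap.ker (lcm (S := S) g), inlMap ι κ x ∈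
          LinearMap.ker (lcm (S := S) (Sum.elim (fun i => s.i (g i)) l)) := by
        intro x hx
        rw [LinearMap.mem_ker] at hx ⊢
        rw [key]
        have e1 : (inlMap ι κ x) ∘ Sum.inl = x := rfl
        have e2 : (inlMap ι κ x) ∘ Sum.inr = 0 := rfl
        rw [e1, e2, hx, map_zero, lcm_apply]
        simp
      have hp' : ∀ x ∈ LinearMap.ker (lcm (S := S) (Sum.elim (fun i => s.i (g i)) l)),
          LinearMap.funLeft S S (Sum.inr : κ → ι ⊕ κ) x ∈ LinearMap.ker (lcm (S := S) h) := by
        intro x hx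
        rw [LinearMap.mem_ker] at hx ⊢
        rw [key] at hx
        rw [← kp]
        have := congrArg s.p hx
        rw [map_add, pi0, zero_add, map_zero] at this
        exact this
      refine ih (A := KerG tw (LinearMap.ker (lcm (S := S) g)))
        (C := KerG tx (LinearMap.ker (lcm (S := S) h))) ?_ a5 c5
      refine
        { i := LinearMap.restrict (inlMap ι κ) hi'
          p := LinearMap.restrict (LinearMap.funLeft S S (Sum.inr : κ → ι ⊕ κ)) hp'
          inj := ?_, surj := ?_, exact := ?_, i_gr := ?_, i_refl := ?_, p_gr := ?_, p_lift := ?_ }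
      · rintro ⟨x, hx⟩ ⟨y, hy⟩ hxy
        apply Subtype.ext
        have := congrArg Subtype.val hxy
        funext j
        exact congrFun this (Sum.inl j)
      · rintro ⟨v, hv⟩
        rw [LinearMap.mem_ker] at hv
        obtain ⟨a, ha⟩ := (s.exact (lcm l v)).1 (by rw [kp, hv])
        obtain ⟨w, hw'⟩ := a4 (-a)
        refine ⟨⟨Sum.elim w v, ?_⟩, ?_⟩
        · rw [LinearMap.mem_ker, key]
          simp only [Sum.elim_comp_inl, Sum.elim_comp_inr]
          rw [hw', ← ha, map_neg, neg_add_cancel]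
        · rfl
      · rintro ⟨x, hx⟩
        constructor
        · intro h0
          have h0 : x ∘ Sum.inr = 0 := congrArg Subtype.val h0
          rw [LinearMap.mem_ker, key, h0] at hx
          have hz : lcm (S := S) l 0 = 0 := map_zero _
          rw [hz, add_zero] at hx
          refine ⟨⟨x ∘ Sum.inl, ?_⟩, ?_⟩
          · rw [LinearMap.mem_ker]
            exact s.inj (by rw [hx, map_zero])
          · apply Subtype.ext
            funext j
            rcases j with j | j
            · rfl
            · exact (congrFun h0 j).symm
        · rintro ⟨a, ha⟩
          rw [← ha]
          rfl
      · rintro d ⟨a, ha⟩ h (j | j)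
        · exact h j
        · exact zero_mem _
      · rintro d ⟨a, ha⟩ h j
        exact h (Sum.inl j)
      · rintro d ⟨a, ha⟩ h j
        exact h (Sum.inr j)
      · rintro d ⟨v, hv⟩ hvd
        rw [LinearMap.mem_ker] at hv
        obtain ⟨a, ha⟩ := (s.exact (lcm l v)).1 (by rw [kp, hv])
        have hag : a ∈ A.gr d := s.i_refl d a (by rw [ha]; exact lgr d v hvd)
        obtain ⟨w, hw, hw'⟩ := a3 d (-a) (neg_mem hag)
        refine ⟨⟨Sum.elim w v, ?_⟩, ?_, ?_⟩
        · rw [LinearMap.mem_ker, key]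
          simp only [Sum.elim_comp_inl, Sum.elim_comp_inr]
          rw [hw', ← ha, map_neg, neg_add_cancel]
        · rintro (j | j)
          · exact hw j
          · exact hvd j
        · rfl

end C6

namespace C6
universe u
set_option linter.unusedSectionVars false
set_option linter.unusedVariables false
open ZG
variable {S : Type u} [CommRing S] [ZG S]

theorem lcm_gr {ι : Type} [Fintype ι] {X : GM S} {tw : ι → ℤ} {g : ι → X.M}
    (hg : ∀ i, g i ∈ X.gr (tw i)) {d : ℤ} {v : ι → S} (hv : v ∈ fgr tw d) :
    lcm g v ∈ X.gr d := by
  rw [lcm_apply]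
  refine sum_mem fun k _ => ?_
  have := X.smul_mem (hv k) (hg k)
  rwa [sub_add_cancel] at this

/-- the inverse of `i` on the kernel of `p` -/
noncomputable def SES.inv {A B C : GM S} (s : SES A B C) : LinearMap.ker s.p →ₗ[S] A.M where
  toFun b := ((s.exact b.1).1 b.2).choose
  map_add' x y := s.inj (by
    rw [map_add, ((s.exact x.1).1 x.2).choose_spec, ((s.exact y.1).1 y.2).choose_spec,
      ((s.exact (x + y).1).1 (x + y).2).choose_spec]; rfl)
  map_smul' c x := s.inj (by
    rw [map_smul, ((s.exact x.1).1 x.2).choose_spec,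
      ((s.exact (c • x).1).1 (c • x).2).choose_spec]; rfl)

theorem SES.i_inv {A B C : GM S} (s : SES A B C) (b : LinearMap.ker s.p) : s.i (s.inv b) = b.1 :=
  ((s.exact b.1).1 b.2).choose_spec

def RegLE (X : GM S) (lo hi : ℤ) : Prop := ∃ n, Res n X lo hi

theorem RegLE.mono {X : GM S} {lo hi lo' hi' : ℤ} (h : RegLE X lo hi) (h1 : lo' ≤ lo)
    (h2 : hi ≤ hi') : RegLE X lo' hi' := h.imp fun _ h => h.mono h1 h2

theorem RegLE.ext {A B C : GM S} (s : SES A B C) {lo hi : ℤ} (hA : RegLE A lo hi)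
    (hC : RegLE C lo hi) : RegLE B lo hi := by
  obtain ⟨n, hn⟩ := hA
  obtain ⟨m, hm⟩ := hC
  exact ⟨max n m, Res.ext s (hn.mono_n (le_max_left _ _)) (hm.mono_n (le_max_right _ _))⟩

theorem RegLE.quot {A B C : GM S} (s : SES A B C) {lo hi : ℤ} (hA : RegLE A lo (hi + 1))
    (hB : RegLE B lo hi) : RegLE C lo hi := by
  obtain ⟨m, hm⟩ := hB
  obtain ⟨ι, _, tw, g, b1, b2, b3, b4, b5⟩ := hm.succ
  have key : ∀ v : ι → S, lcm (fun i => s.p (g i)) v = s.p (lcm g v) := by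
    intro v; simp [lcm_apply]
  suffices h : RegLE (KerG tw (LinearMap.ker (lcm (S := S) fun i => s.p (g i)))) lo (hi + 1) by
    obtain ⟨n, hn⟩ := h
    refine ⟨n + 1, ι, inferInstance, tw, fun i => s.p (g i), b1, fun i => s.p_gr _ _ (b2 i), ?_, ?_, hn⟩
    · intro d x hx
      obtain ⟨b, hb, rfl⟩ := s.p_lift d x hx
      obtain ⟨v, hv, rfl⟩ := b3 d b hb
      exact ⟨v, hv, key v⟩
    · intro x
      obtain ⟨b, rfl⟩ := s.surj x
      obtain ⟨v, rfl⟩ := b4 b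
      exact ⟨v, key v⟩
  have hpk : ∀ x ∈ LinearMap.ker (lcm (S := S) fun i => s.p (g i)), lcm g x ∈ LinearMap.ker s.p := by
    intro x hx
    rw [LinearMap.mem_ker, key] at hx
    exact hx
  have hle : LinearMap.ker (lcm (S := S) g) ≤ LinearMap.ker (lcm (S := S) fun i => s.p (g i)) := by
    intro x hx
    rw [LinearMap.mem_ker] at hx ⊢
    rw [key, hx, map_zero]
  let P := s.inv ∘ₗ LinearMap.restrict (lcm (S := S) g) hpk
  have iP : ∀ x, s.i (P x) = lcm g x.1 := fun x => s.i_inv _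
  refine RegLE.ext (A := KerG tw (LinearMap.ker (lcm (S := S) g))) (C := A) ?_ ⟨_, b5⟩ hA
  refine { i := Submodule.inclusion hle, p := P,
           inj := Submodule.inclusion_injective hle, surj := ?_, exact := ?_, i_gr := ?_, i_refl := ?_, p_gr := ?_, p_lift := ?_ }
  · intro a
    obtain ⟨v, hv⟩ := b4 (s.i a)
    refine ⟨⟨v, ?_⟩, s.inj ?_⟩
    · rw [LinearMap.mem_ker, key, hv]
      exact (s.exact _).2 ⟨a, rfl⟩
    · rw [iP]; exact hv
  · intro b
    constructor
    · intro hb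
      refine ⟨⟨b.1, ?_⟩, rfl⟩
      rw [LinearMap.mem_ker, ← iP, hb, map_zero]
    · rintro ⟨a, rfl⟩
      refine s.inj ?_
      rw [iP, map_zero]
      exact a.2
  · intro d a h; exact h
  · intro d a h; exact h
  · intro d b h
    refine s.i_refl _ _ ?_
    rw [iP]
    exact lcm_gr b2 h
  · intro d a ha
    obtain ⟨v, hv, hv'⟩ := b3 d (s.i a) (s.i_gr _ _ ha)
    refine ⟨⟨v, ?_⟩, hv, s.inj ?_⟩
    · rw [LinearMap.mem_ker, key, hv']
      exact (s.exact _).2 ⟨a, rfl⟩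
    · rw [iP]; exact hv'

theorem RegLE.free {ι : Type} [Fintype ι] {tw : ι → ℤ} {lo hi : ℤ}
    (h : ∀ i, lo ≤ tw i ∧ tw i ≤ hi) : RegLE (FreeG (S := S) ι tw) lo hi := by
  classical
  have key : ∀ v : ι → S, lcm (fun i => (Pi.single i 1 : ι → S)) v = v := by
    intro v
    rw [lcm_apply]
    funext j
    simp [Finset.sum_apply, Pi.single_apply]
  refine ⟨1, ι, inferInstance, tw, fun i => Pi.single i 1, h, ?_, ?_, ?_, ?_⟩
  · intro i j
    by_cases hij : j = i
    · subst hij; simpa using hd_one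
    · simp [hij]
  · intro d x hx
    exact ⟨x, hx, key x⟩
  · intro x; exact ⟨x, key x⟩
  · show Subsingleton _
    have h0 : ∀ x : LinearMap.ker (lcm (S := S) fun i => (Pi.single i 1 : ι → S)), x = 0 := by
      intro x
      apply Subtype.ext
      have := x.2
      rw [LinearMap.mem_ker, key] at this
      exact this
    exact ⟨fun x y => by rw [h0 x, h0 y]⟩

theorem RegLE.ker {A B C : GM S} (s : SES A B C) {lo hi : ℤ} (hB : RegLE B lo (hi + 1))
    (hC : RegLE C lo hi) : RegLE A lo (hi + 1) := by
  obtain ⟨m, hm⟩ := hC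
  obtain ⟨ι, _, tw, g, b1, b2, b3, b4, b5⟩ := hm.succ
  choose l l1 l2 using fun k => s.p_lift _ _ (b2 k)
  have kp : ∀ v : ι → S, s.p (lcm l v) = lcm g v := by
    intro v; simp [lcm_apply, l2]
  let P : Submodule S (B.M × (ι → S)) :=
    LinearMap.ker (s.p ∘ₗ LinearMap.fst S _ _ - lcm (S := S) g ∘ₗ LinearMap.snd S _ _)
  have mP : ∀ x, x ∈ P ↔ s.p x.1 = lcm g x.2 := by
    intro x
    rw [LinearMap.mem_ker]
    simp [sub_eq_zero]
  let PG : GM S := SubG (ProdG B (FreeG ι tw)) P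
  have hPG : RegLE PG lo (hi + 1) := by
    refine RegLE.ext (A := KerG tw (LinearMap.ker (lcm (S := S) g))) (C := B) ?_ ⟨_, b5⟩ hB
    refine { i := LinearMap.restrict (LinearMap.inr S B.M (ι → S)) ?_,
             p := (LinearMap.fst S B.M (ι → S)) ∘ₗ P.subtype,
             inj := ?_, surj := ?_, exact := ?_, i_gr := ?_, i_refl := ?_, p_gr := ?_, p_lift := ?_ }
    · intro x hx
      rw [mP]
      rw [LinearMap.mem_ker] at hx
      simp [hx]
    · intro x y hxy
      apply Subtype.ext
      exact congrArg (fun z => z.1.2) hxy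
    · intro b
      obtain ⟨v, hv⟩ := b4 (s.p b)
      exact ⟨⟨(b, v), (mP _).2 hv.symm⟩, rfl⟩
    · rintro ⟨⟨b, v⟩, hb⟩
      constructor
      · intro h0
        have h0 : b = 0 := h0
        subst h0
        have := (mP _).1 hb
        simp only [map_zero] at this
        exact ⟨⟨v, this.symm⟩, rfl⟩
      · rintro ⟨a, ha⟩
        rw [← ha]
        rfl
    · intro d a h
      exact ⟨zero_mem _, h⟩
    · intro d a h
      exact h.2
    · intro d a h
      exact h.1
    · intro d b hb
      obtain ⟨v, hv, hv'⟩ := b3 d _ (s.p_gr d b hb)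
      exact ⟨⟨(b, v), (mP _).2 hv'.symm⟩, ⟨hb, hv⟩, rfl⟩
  have hQ : ∀ x ∈ P, (LinearMap.fst S B.M (ι → S) - lcm (S := S) l ∘ₗ LinearMap.snd S B.M (ι → S)) x
      ∈ LinearMap.ker s.p := by
    intro x hx
    rw [mP] at hx
    rw [LinearMap.mem_ker]
    simp [hx, kp]
  let Pr := s.inv ∘ₗ LinearMap.restrict _ hQ
  have iP : ∀ x : P, s.i (Pr x) = x.1.1 - lcm l x.1.2 := fun x => s.i_inv _
  refine RegLE.quot (A := FreeG ι tw) (B := PG) (C := A) ?_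
    (RegLE.free fun i => ⟨(b1 i).1, (b1 i).2.trans (by omega)⟩) hPG
  refine { i := LinearMap.codRestrict P (LinearMap.prod (lcm (S := S) l) LinearMap.id) ?_,
           p := Pr,
           inj := ?_, surj := ?_, exact := ?_, i_gr := ?_, i_refl := ?_, p_gr := ?_, p_lift := ?_ }
  · intro v
    rw [mP]
    exact kp v
  · intro x y hxy
    exact congrArg (fun z => z.1.2) hxy
  · intro a
    refine ⟨⟨(s.i a, 0), (mP _).2 ?_⟩, s.inj ?_⟩
    · simp only [map_zero]
      exact (s.exact _).2 ⟨a, rfl⟩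
    · rw [iP]; simp
  · rintro ⟨⟨b, v⟩, hb⟩
    constructor
    · intro h0
      have := iP ⟨(b, v), hb⟩
      rw [h0, map_zero] at this
      refine ⟨v, Subtype.ext (Prod.ext (sub_eq_zero.1 this.symm).symm rfl)⟩
    · rintro ⟨a, ha⟩
      refine s.inj ?_
      rw [iP, map_zero, ← ha]
      exact sub_self _
  · intro d a h
    exact ⟨lcm_gr l1 h, h⟩
  · intro d a h
    exact h.2
  · intro d b h
    refine s.i_refl _ _ ?_
    rw [iP]
    exact sub_mem h.1 (lcm_gr l1 h.2)
  · intro d a ha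
    refine ⟨⟨(s.i a, 0), (mP _).2 ?_⟩, ⟨s.i_gr _ _ ha, zero_mem _⟩, s.inj ?_⟩
    · simp only [map_zero]
      exact (s.exact _).2 ⟨a, rfl⟩
    · rw [iP]; simp

theorem shift_ker {ι : Type} (tw : ι → ℤ) (N : Submodule S (ι → S)) (k : ℤ) :
    KerG (fun i => tw i + k) N = shift k (KerG tw N) := by
  have : ∀ d, fgr (S := S) (fun i => tw i + k) d = fgr tw (d - k) := by
    intro d
    ext v
    show (∀ i, _) ↔ ∀ i, _
    refine forall_congr' fun i => ?_
    rw [show d - (tw i + k) = d - k - tw i by ring]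
  simp only [KerG, shift, this]

theorem Res.shift {n : ℕ} {X : GM S} {lo hi : ℤ} (h : Res n X lo hi) (k : ℤ) :
    Res n (C6.shift k X) (lo + k) (hi + k) := by
  induction n generalizing X hi with
  | zero => exact h
  | succ n ih =>
    obtain ⟨ι, _, tw, g, a, b, c, d, e⟩ := h
    refine ⟨ι, _, fun i => tw i + k, g, ?_, ?_, ?_, d, ?_⟩
    · intro i; have := a i; constructor <;> dsimp only <;> omega
    · intro i
      show g i ∈ X.gr _
      rw [add_sub_cancel_right]
      exact b i
    · intro d x hx
      obtain ⟨v, hv, hv'⟩ := c (d - k) x hx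
      refine ⟨v, ?_, hv'⟩
      intro i
      rw [show d - (tw i + k) = d - k - tw i by ring]
      exact hv i
    · rw [shift_ker]
      have := ih e
      rwa [show hi + 1 + k = hi + k + 1 by ring] at this

theorem RegLE.shift {X : GM S} {lo hi : ℤ} (h : RegLE X lo hi) (k : ℤ) :
    RegLE (C6.shift k X) (lo + k) (hi + k) := h.imp fun _ h => h.shift k

theorem RegLE.unshift {X : GM S} {lo hi : ℤ} (k : ℤ) (h : RegLE (C6.shift k X) lo hi) :
    RegLE X (lo - k) (hi - k) := by
  have := h.shift (-k)
  have e : C6.shift (-k) (C6.shift k X) = X := by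
    cases X
    simp only [C6.shift]
    congr
    funext d
    congr 1
    ring
  rw [e] at this
  exact this

end C6

namespace C6
universe u
set_option linter.unusedSectionVars false
set_option linter.unusedVariables false
open ZG
variable {S : Type u} [CommRing S] [ZG S]

/-- The subquotient `A / (A ∩ B)` as a graded module. -/
abbrev Q (A B : Ideal S) : GM S where
  M := A ⧸ (Submodule.comap (Submodule.subtype A) B)
  gr d := ((hd d).comap (Submodule.subtype A).toAddMonoidHom).map
    (Submodule.mkQ (Submodule.comap (Submodule.subtype A) B)).toAddMonoidHom
  smul_mem := by
    rintro a b p m hp ⟨x, hx, rfl⟩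
    exact ⟨p • x, hd_mul hp hx, rfl⟩

def IsH (I : Ideal S) : Prop := ∃ s : Set S, (∀ f ∈ s, ∃ k, f ∈ hd k) ∧ I = Ideal.span s

theorem IsH.cmp {I : Ideal S} (h : IsH I) {p : S} (hp : p ∈ I) (d : ℤ) : cmp d p ∈ I := by
  obtain ⟨s, hs, rfl⟩ := h
  induction hp using Submodule.span_induction generalizing d with
  | mem x hx =>
    obtain ⟨k, hk⟩ := hs x hx
    have := cmp_mul hk d 1
    rw [mul_one] at this
    rw [this]
    exact Ideal.mul_mem_right _ _ (Ideal.subset_span hx)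
  | zero => rw [map_zero]; exact zero_mem _
  | add x y _ _ hx hy => rw [map_add]; exact add_mem (hx d) (hy d)
  | smul a x hx' hx =>
    clear hx
    induction hx' using Submodule.span_induction generalizing a with
    | mem x hx =>
      obtain ⟨k, hk⟩ := hs x hx
      rw [smul_eq_mul, mul_comm, cmp_mul hk]
      exact Ideal.mul_mem_right _ _ (Ideal.subset_span hx)
    | zero => rw [smul_zero, map_zero]; exact zero_mem _
    | add x y _ _ hx hy => rw [smul_add, map_add]; exact add_mem (hx a) (hy a)
    | smul b x _ hx => rw [smul_smul]; exact hx _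

theorem IsH.span {s : Set S} (hs : ∀ f ∈ s, ∃ k, f ∈ hd k) : IsH (Ideal.span s) := ⟨s, hs, rfl⟩

theorem IsH.single {f : S} {k : ℤ} (hf : f ∈ hd k) : IsH (Ideal.span {f}) :=
  IsH.span (by rintro _ rfl; exact ⟨k, hf⟩)

theorem IsH.bot : IsH (⊥ : Ideal S) := ⟨∅, by simp, by simp⟩

theorem IsH.top : IsH (⊤ : Ideal S) := ⟨{1}, by rintro _ rfl; exact ⟨0, hd_one⟩, by simp⟩

theorem IsH.sup {I J : Ideal S} (hI : IsH I) (hJ : IsH J) : IsH (I ⊔ J) := by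
  obtain ⟨s, hs, rfl⟩ := hI
  obtain ⟨t, ht, rfl⟩ := hJ
  exact ⟨s ∪ t, by rintro f (h | h); exacts [hs f h, ht f h], by rw [Ideal.span_union]⟩

theorem IsH.mul {I J : Ideal S} (hI : IsH I) (hJ : IsH J) : IsH (I * J) := by
  obtain ⟨s, hs, rfl⟩ := hI
  obtain ⟨t, ht, rfl⟩ := hJ
  refine ⟨{f | ∃ a ∈ s, ∃ b ∈ t, f = a * b}, ?_, ?_⟩
  · rintro f ⟨a, ha, b, hb, rfl⟩
    obtain ⟨i, hi⟩ := hs a ha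
    obtain ⟨j, hj⟩ := ht b hb
    exact ⟨_, hd_mul hi hj⟩
  · rw [Ideal.span_mul_span]
    congr 1
    ext f
    simp [Set.mem_mul, eq_comm]

theorem IsH.pow {I : Ideal S} (hI : IsH I) (n : ℕ) : IsH (I ^ n) := by
  induction n with
  | zero => rw [pow_zero, Ideal.one_eq_top]; exact IsH.top
  | succ n ih => rw [pow_succ]; exact ih.mul hI

/-- The basic exact sequence given by multiplication with `f`. -/
noncomputable def sesMul {f : S} {k : ℤ} (hf : f ∈ hd k) {A A' B B' B'' : Ideal S} (hA' : IsH A') (hB : IsH B)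
    (hm : ∀ a ∈ A', f * a ∈ A) (hiff : ∀ a ∈ A', f * a ∈ B ↔ a ∈ B')
    (hB'' : B'' = B ⊔ Ideal.span {f} * A') :
    SES (shift k (Q A' B')) (Q A B) (Q A B'') := by
  have hl : ∀ x ∈ A', (LinearMap.mulLeft S f) x ∈ A := hm
  have hle : Submodule.comap (Submodule.subtype A') B' ≤
      Submodule.comap (LinearMap.restrict (LinearMap.mulLeft S f) hl) (Submodule.comap (Submodule.subtype A) B) := by
    intro x hx
    exact (hiff x.1 x.2).2 hx
  have hle2 : Submodule.comap (Submodule.subtype A) B ≤ Submodule.comap (Submodule.subtype A) B'' := by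
    rw [hB'']
    exact Submodule.comap_mono le_sup_left
  refine { i := Submodule.mapQ _ _ (LinearMap.restrict (LinearMap.mulLeft S f) hl) hle,
           p := Submodule.factor hle2, inj := ?_, surj := Submodule.factor_surjective hle2, exact := ?_, i_gr := ?_, i_refl := ?_,
           p_gr := ?_, p_lift := ?_ }
  · rw [← LinearMap.ker_eq_bot, LinearMap.ker_eq_bot']
    intro x hx
    obtain ⟨x, rfl⟩ := Submodule.Quotient.mk_surjective _ x
    rw [Submodule.mapQ_apply, Submodule.Quotient.mk_eq_zero] at hx
    rw [Submodule.Quotient.mk_eq_zero]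
    exact (hiff x.1 x.2).1 hx
  · intro b
    obtain ⟨x, rfl⟩ := Submodule.Quotient.mk_surjective _ b
    constructor
    · intro h
      have h : Submodule.Quotient.mk x = (0 : A ⧸ Submodule.comap (Submodule.subtype A) B'') := h
      rw [Submodule.Quotient.mk_eq_zero, hB''] at h
      obtain ⟨b, hb, c, hc, h⟩ := Submodule.mem_sup.1 h
      obtain ⟨z, hz, rfl⟩ := Ideal.mem_span_singleton_mul.1 hc
      refine ⟨Submodule.Quotient.mk ⟨z, hz⟩, ?_⟩
      rw [Submodule.mapQ_apply, Submodule.Quotient.eq]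
      show f * z - x.1 ∈ B
      have : f * z - x.1 = - b := by
        have h : b + f * z = x.1 := h
        rw [← h]; ring
      rw [this]
      exact neg_mem hb
    · rintro ⟨a, ha⟩
      obtain ⟨a, rfl⟩ := Submodule.Quotient.mk_surjective _ a
      rw [← ha]
      rw [Submodule.mapQ_apply]
      show Submodule.Quotient.mk _ = (0 : A ⧸ Submodule.comap (Submodule.subtype A) B'')
      rw [Submodule.Quotient.mk_eq_zero]
      show f * a.1 ∈ B''
      rw [hB'']
      exact Submodule.mem_sup_right (Ideal.mul_mem_mul (Ideal.mem_span_singleton_self f) a.2)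
  · rintro d _ ⟨x, hx, rfl⟩
    refine ⟨⟨f * x.1, hm _ x.2⟩, ?_, rfl⟩
    have := hd_mul hf (show x.1 ∈ hd (d - k) from hx)
    rw [show k + (d - k) = d by ring] at this
    exact this
  · intro d a h
    obtain ⟨a, rfl⟩ := Submodule.Quotient.mk_surjective _ a
    obtain ⟨x, hx, h⟩ := h
    have h : Submodule.Quotient.mk x = Submodule.Quotient.mk (p := Submodule.comap (Submodule.subtype A) B) (⟨f * a.1, hm _ a.2⟩ : A) := h
    rw [Submodule.Quotient.eq] at h
    have h : x.1 - f * a.1 ∈ B := h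
    have hx : x.1 ∈ hd d := hx
    refine ⟨⟨ZG.cmp (d - k) a.1, hA'.cmp a.2 _⟩, ZG.cmp_mem _ _, ?_⟩
    show Submodule.Quotient.mk _ = _
    rw [Submodule.Quotient.eq]
    show ZG.cmp (d - k) a.1 - a.1 ∈ B'
    rw [← hiff _ (sub_mem (hA'.cmp a.2 _) a.2)]
    have h2 := hB.cmp h d
    rw [map_sub, cmp_self hx, cmp_mul hf] at h2
    have := sub_mem h h2
    convert this using 1
    ring
  · rintro d _ ⟨x, hx, rfl⟩
    exact ⟨x, hx, rfl⟩
  · rintro d _ ⟨x, hx, rfl⟩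
    exact ⟨_, ⟨x, hx, rfl⟩, rfl⟩

def RegQ (A B : Ideal S) (lo hi : ℤ) : Prop := RegLE (Q A B) lo hi

theorem RegQ.mono {A B : Ideal S} {lo hi lo' hi' : ℤ} (h : RegQ A B lo hi) (h1 : lo' ≤ lo)
    (h2 : hi ≤ hi') : RegQ A B lo' hi' := RegLE.mono h h1 h2

theorem RegQ.zero {A B : Ideal S} (h : A ≤ B) (lo hi : ℤ) : RegQ A B lo hi := by
  refine ⟨0, ?_⟩
  show Subsingleton _
  rw [Submodule.Quotient.subsingleton_iff, eq_top_iff]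
  intro x _
  exact h x.2

theorem RegQ.ext {f : S} {k : ℤ} (hf : f ∈ hd k) {A A' B B' B'' : Ideal S} (hA' : IsH A') (hB : IsH B)
    (hm : ∀ a ∈ A', f * a ∈ A) (hiff : ∀ a ∈ A', f * a ∈ B ↔ a ∈ B')
    (hB'' : B'' = B ⊔ Ideal.span {f} * A') {lo' hi' lo hi : ℤ} (h1 : RegQ A' B' lo' hi')
    (h2 : RegQ A B'' lo hi) (hlo : lo ≤ lo' + k) (hhi : hi' + k ≤ hi) : RegQ A B lo hi :=
  RegLE.ext (sesMul hf hA' hB hm hiff hB'') ((RegLE.shift h1 k).mono hlo hhi) h2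

theorem RegQ.quot {f : S} {k : ℤ} (hf : f ∈ hd k) {A A' B B' B'' : Ideal S} (hA' : IsH A') (hB : IsH B)
    (hm : ∀ a ∈ A', f * a ∈ A) (hiff : ∀ a ∈ A', f * a ∈ B ↔ a ∈ B')
    (hB'' : B'' = B ⊔ Ideal.span {f} * A') {lo' hi' lo hi : ℤ} (h1 : RegQ A' B' lo' hi')
    (h2 : RegQ A B lo hi) (hlo : lo ≤ lo' + k) (hhi : hi' + k ≤ hi + 1) : RegQ A B'' lo hi :=
  RegLE.quot (sesMul hf hA' hB hm hiff hB'') ((RegLE.shift h1 k).mono hlo hhi) h2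

theorem RegQ.ker {f : S} {k : ℤ} (hf : f ∈ hd k) {A A' B B' B'' : Ideal S} (hA' : IsH A') (hB : IsH B)
    (hm : ∀ a ∈ A', f * a ∈ A) (hiff : ∀ a ∈ A', f * a ∈ B ↔ a ∈ B')
    (hB'' : B'' = B ⊔ Ideal.span {f} * A') {lo hi : ℤ} (h1 : RegQ A B lo (hi + 1))
    (h2 : RegQ A B'' lo hi) : RegQ A' B' (lo - k) (hi + 1 - k) :=
  RegLE.unshift k (RegLE.ker (sesMul hf hA' hB hm hiff hB'') h1 h2)

theorem RegQ.base : RegQ (⊤ : Ideal S) ⊥ 0 0 := by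
  refine ⟨1, Unit, inferInstance, fun _ => 0, fun _ => Submodule.Quotient.mk ⟨1, trivial⟩, by simp, ?_, ?_, ?_, ?_⟩
  · intro _
    exact ⟨⟨1, trivial⟩, hd_one, rfl⟩
  · rintro d _ ⟨x, hx, rfl⟩
    refine ⟨fun _ => x.1, ?_, ?_⟩
    · intro _; simpa using hx
    · rw [lcm_apply]
      simp only [Finset.univ_unique, Finset.sum_singleton]
      rw [← Submodule.Quotient.mk_smul]
      show Submodule.Quotient.mk _ = Submodule.Quotient.mk _
      congr 1
      apply Subtype.ext
      simp
  · intro x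
    obtain ⟨x, rfl⟩ := Submodule.Quotient.mk_surjective _ x
    refine ⟨fun _ => x.1, ?_⟩
    rw [lcm_apply]
    simp only [Finset.univ_unique, Finset.sum_singleton]
    rw [← Submodule.Quotient.mk_smul]
    congr 1
    apply Subtype.ext
    simp
  · show Subsingleton _
    rw [Submodule.subsingleton_iff_eq_bot, LinearMap.ker_eq_bot']
    intro v hv
    rw [lcm_apply] at hv
    simp only [Finset.univ_unique, Finset.sum_singleton] at hv
    rw [← Submodule.Quotient.mk_smul, Submodule.Quotient.mk_eq_zero] at hv
    funext j
    have hv : v j • (1 : S) = 0 := hv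
    simpa using hv

theorem Res.conv {n : ℕ} {X : GM S} {hi : ℤ} (h : Res n X 0 hi) :
    ∃ (ι : ℕ → Type) (_ : ∀ i, Fintype (ι i)) (tw : (i : ℕ) → ι i → ℤ) (g : ι 0 → X.M)
      (mat : (i : ℕ) → ι i → ι (i + 1) → S),
      (∀ i, n ≤ i → IsEmpty (ι i)) ∧ (∀ i r, 0 ≤ tw i r ∧ tw i r ≤ hi + i) ∧
      (∀ r, g r ∈ X.gr (tw 0 r)) ∧ (∀ i r c, mat i r c ∈ hd (tw (i + 1) c - tw i r)) ∧
      Function.Surjective (lcm (S := S) g) ∧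
      (∀ v : ι 0 → S, lcm g v = 0 ↔ ∃ w : ι 1 → S, ∀ r, v r = ∑ c, mat 0 r c * w c) ∧
      (∀ i, ∀ v : ι (i + 1) → S, (∀ r, ∑ c, mat i r c * v c = 0) ↔
        ∃ w : ι (i + 2) → S, ∀ r, v r = ∑ c, mat (i + 1) r c * w c) := by
  induction n generalizing X hi with
  | zero =>
    have h : Subsingleton X.M := h
    refine ⟨fun _ => Empty, fun _ => inferInstance, fun _ => Empty.elim, Empty.elim, fun _ => Empty.elim,
      fun _ _ => inferInstance, fun i r => r.elim, fun r => r.elim, fun i r => r.elim, ?_, ?_, ?_⟩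
    · intro x; exact ⟨0, Subsingleton.elim _ _⟩
    · intro v; exact ⟨fun _ => ⟨0, fun r => r.elim⟩, fun _ => Subsingleton.elim _ _⟩
    · intro i v; exact ⟨fun _ => ⟨0, fun r => r.elim⟩, fun _ r => r.elim⟩
  | succ n ih =>
    obtain ⟨κ, _, tx, h, a1, a2, a3, a4, a5⟩ := h
    obtain ⟨ι, _, tw, g, mat, b1, b2, b3, b4, b5, b6, b7⟩ := ih a5
    refine ⟨fun i => Nat.casesOn i κ ι, fun i => by cases i <;> (dsimp only; infer_instance),
      fun i => match i with | 0 => tx | i + 1 => tw i, h,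
      fun i => match i with | 0 => fun r c => (g c).1 r | i + 1 => mat i, ?_, ?_, a2, ?_, a4, ?_, ?_⟩
    · rintro (_ | i) hi
      · omega
      · exact b1 i (by omega)
    · rintro (_ | i) r
      · have := a1 r
        exact ⟨this.1, by simpa using this.2⟩
      · have := b2 i r
        refine ⟨this.1, ?_⟩
        push_cast
        have := this.2
        show tw i r ≤ _
        omega
    · rintro (_ | i) r c
      · exact b3 c r
      · exact b4 i r c
    · intro v
      constructor
      · intro hv
        obtain ⟨w, hw⟩ := b5 ⟨v, hv⟩
        refine ⟨w, fun r => ?_⟩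
        have := congrArg (fun z => z.1 r) hw
        dsimp only at this
        rw [lcm_apply] at this
        rw [← this]
        simp only [Submodule.coe_sum, Finset.sum_apply, Submodule.coe_smul, Pi.smul_apply, smul_eq_mul]
        refine Finset.sum_congr rfl fun c _ => mul_comm _ _
      · rintro ⟨w, hw⟩
        have : v = (lcm (S := S) g w).1 := by
          funext r
          rw [hw, lcm_apply]
          simp only [Submodule.coe_sum, Finset.sum_apply, Submodule.coe_smul, Pi.smul_apply, smul_eq_mul]
          exact Finset.sum_congr rfl fun c _ => mul_comm _ _
        rw [this]
        exact (lcm (S := S) g w).2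
    · rintro (_ | i) v
      · have := b6 v
        rw [← this]
        rw [Subtype.ext_iff, funext_iff]
        refine forall_congr' fun r => ?_
        rw [lcm_apply]
        simp only [Submodule.coe_sum, Finset.sum_apply, Submodule.coe_smul, Pi.smul_apply, smul_eq_mul]
        have e : ∀ c, v c * (g c).1 r = (g c).1 r * v c := fun c => mul_comm _ _
        simp only [e]
        rfl
      · exact b7 i v

end C6

namespace C6
universe u
set_option linter.unusedSectionVars false
set_option linter.unusedVariables false
open ZG

section
variable {σ : Type} {K : Type u} [Field K]

def hdP (d : ℤ) : AddSubgroup (MvPolynomial σ K) where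
  carrier := {p | ∀ e, coeff e p ≠ 0 → (e.degree : ℤ) = d}
  zero_mem' := by intro e h; simp at h
  add_mem' := by
    intro a b ha hb e h
    rw [coeff_add] at h
    by_cases h1 : coeff e a = 0
    · exact hb e (by simpa [h1] using h)
    · exact ha e h1
  neg_mem' := by
    intro a ha e h
    exact ha e (by simpa using h)

noncomputable def cmpP (d : ℤ) : MvPolynomial σ K →+ MvPolynomial σ K :=
  if 0 ≤ d then (homogeneousComponent d.toNat).toAddMonoidHom else 0

theorem coeff_cmpP (d : ℤ) (p : MvPolynomial σ K) (e : σ →₀ ℕ) :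
    coeff e (cmpP d p) = if (e.degree : ℤ) = d then coeff e p else 0 := by
  unfold cmpP
  split_ifs with h h2 h2
  · show coeff e (homogeneousComponent d.toNat p) = _
    rw [coeff_homogeneousComponent, if_pos (by omega)]
  · show coeff e (homogeneousComponent d.toNat p) = _
    rw [coeff_homogeneousComponent, if_neg (by omega)]
  · omega
  · simp

noncomputable instance : ZG (MvPolynomial σ K) where
  hd := hdP
  cmp := cmpP
  hd_mul := by
    intro i j a b ha hb e h
    classical
    rw [coeff_mul] at h
    obtain ⟨x, hx, hx'⟩ := Finset.exists_ne_zero_of_sum_ne_zero h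
    rw [Finset.HasAntidiagonal.mem_antidiagonal] at hx
    have h1 := ha x.1 (left_ne_zero_of_mul hx')
    have h2 := hb x.2 (right_ne_zero_of_mul hx')
    rw [← hx, map_add]
    push_cast
    omega
  hd_one := by
    intro e h
    classical
    rw [coeff_one] at h
    split_ifs at h with h1
    · subst h1; simp
    · simp at h
  cmp_mem := by
    intro d p e h
    rw [coeff_cmpP] at h
    by_contra hh
    simp [hh] at h
  cmp_self := by
    intro d p h
    ext e
    rw [coeff_cmpP]
    split_ifs with h1
    · rfl
    · by_contra h2
      exact h1 (h e (Ne.symm h2))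
  cmp_mul := by
    intro k f hf d a
    ext e
    classical
    rw [coeff_cmpP, coeff_mul, coeff_mul]
    have : ∀ x ∈ Finset.HasAntidiagonal.antidiagonal e, coeff x.1 f * coeff x.2 (cmpP (d - k) a) =
        if (e.degree : ℤ) = d then coeff x.1 f * coeff x.2 a else 0 := by
      intro x hx
      rw [Finset.HasAntidiagonal.mem_antidiagonal] at hx
      by_cases h0 : coeff x.1 f = 0
      · simp [h0]
      · have h1 := hf x.1 h0
        rw [coeff_cmpP]
        have : (e.degree : ℤ) = x.1.degree + x.2.degree := by rw [← hx, map_add]; push_cast; rfl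
        by_cases h2 : (e.degree : ℤ) = d
        · rw [if_pos h2, if_pos (by omega)]
        · rw [if_neg h2, if_neg (by omega), mul_zero]
    rw [Finset.sum_congr rfl this]
    split_ifs <;> simp

theorem mem_hd {d : ℤ} {p : MvPolynomial σ K} :
    p ∈ hd d ↔ ∀ e, coeff e p ≠ 0 → (e.degree : ℤ) = d := Iff.rfl

theorem hd_nat {n : ℕ} {p : MvPolynomial σ K} : p ∈ hd (n : ℤ) ↔ p.IsHomogeneous n := by
  rw [mem_hd]
  constructor
  · intro h e he
    have := h e he
    have h2 := congrArg (fun f => f e) (Finsupp.degree_eq_weight_one (R := ℕ) (σ := σ))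
    refine h2.symm.trans ?_
    exact_mod_cast this
  · intro h e he
    have := h he
    have h2 := congrArg (fun f => f e) (Finsupp.degree_eq_weight_one (R := ℕ) (σ := σ))
    exact_mod_cast h2.trans this

theorem hd_neg {d : ℤ} (hd0 : d < 0) {p : MvPolynomial σ K} (hp : p ∈ hd d) : p = 0 := by
  ext e
  by_contra h
  have := mem_hd.1 hp e h
  omega

theorem hd_X (z : σ) : (X z : MvPolynomial σ K) ∈ hd 1 := by
  have := (hd_nat (n := 1)).2 (isHomogeneous_X K z)
  simpa using this

theorem hd_sub_eq {a b : ℕ} {p : MvPolynomial σ K} (h : p ∈ hd ((b : ℤ) - a)) :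
    if a ≤ b then p.IsHomogeneous (b - a) else p = 0 := by
  split_ifs with hab
  · rw [← hd_nat]; push_cast [hab]; exact h
  · exact hd_neg (by omega) h

theorem conv {J : Ideal (MvPolynomial σ K)} {m : ℕ} (h : RegQ ⊤ J 0 m) :
    ∃ F : GradedFreeResolution (K := K) J, ∀ (i : ℕ) (r : Fin (F.rk i)), F.tw i r ≤ m + i := by
  obtain ⟨n, h⟩ := h
  obtain ⟨ι, _, tw, g, mat, b1, b2, b3, b4, b5, b6, b7⟩ := h.conv
  have b3' : ∀ r, ∃ a : MvPolynomial σ K, a ∈ hd (tw 0 r) ∧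
      g r = Submodule.Quotient.mk (⟨a, trivial⟩ : (⊤ : Ideal (MvPolynomial σ K))) := by
    intro r
    obtain ⟨x, hx, hx'⟩ := b3 r
    exact ⟨x.1, hx, hx'.symm⟩
  choose a a1 a2 using b3'
  have key : ∀ v : ι 0 → MvPolynomial σ K, lcm g v =
      Submodule.Quotient.mk (⟨∑ r, a r * v r, trivial⟩ : (⊤ : Ideal (MvPolynomial σ K))) := by
    intro v
    rw [lcm_apply]
    simp only [a2, ← Submodule.Quotient.mk_smul]
    have := map_sum (Submodule.mkQ (Submodule.comap (Submodule.subtype ⊤) J)) (fun r => v r • (⟨a r, trivial⟩ : (⊤ : Ideal (MvPolynomial σ K)))) Finset.univ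
    refine this.symm.trans ?_
    show Submodule.Quotient.mk _ = _
    congr 1
    apply Subtype.ext
    simp [mul_comm]
  have key0 : ∀ v : ι 0 → MvPolynomial σ K, lcm g v = 0 ↔ ∑ r, a r * v r ∈ J := by
    intro v
    rw [key, Submodule.Quotient.mk_eq_zero]
    rfl
  have tn : ∀ i r, ((tw i r).toNat : ℤ) = tw i r := fun i r => Int.toNat_of_nonneg (b2 i r).1
  let e : ∀ i, Fin (Fintype.card (ι i)) ≃ ι i := fun i => (Fintype.equivFin (ι i)).symm
  refine ⟨⟨n, fun i => Fintype.card (ι i), fun i r => (tw i (e i r)).toNat,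
    fun i r c => mat i (e i r) (e (i + 1) c), fun r => a (e 0 r), ?_, ?_, ?_, ?_, ?_, ?_⟩, ?_⟩
  · intro i hi
    have := b1 i hi.le
    exact Fintype.card_eq_zero
  · intro r
    rw [← hd_nat, tn]
    exact a1 _
  · intro i r c
    apply hd_sub_eq
    rw [tn, tn]
    exact b4 _ _ _
  · intro s
    obtain ⟨v, hv⟩ := b5 (Submodule.Quotient.mk ⟨s, trivial⟩)
    rw [key, Submodule.Quotient.eq] at hv
    refine ⟨fun r => v (e 0 r), ?_⟩
    rw [Equiv.sum_comp (e 0) (fun r => a r * v r)]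
    have hv : ∑ r, a r * v r - s ∈ J := hv
    rw [← neg_sub]
    exact neg_mem hv
  · intro v
    have h0 := key0 (v ∘ (e 0).symm)
    rw [b6] at h0
    rw [← Equiv.sum_comp (e 0)] at h0
    simp only [Function.comp_apply, Equiv.symm_apply_apply] at h0
    rw [← h0]
    constructor
    · rintro ⟨w, hw⟩
      refine ⟨w ∘ e 1, fun r => ?_⟩
      have := hw (e 0 r)
      rw [Equiv.symm_apply_apply] at this
      rw [this, ← Equiv.sum_comp (e 1)]
      rfl
    · rintro ⟨w, hw⟩
      refine ⟨w ∘ (e 1).symm, fun r => ?_⟩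
      rw [hw, ← Equiv.sum_comp (e 1)]
      simp
  · intro i v
    have h0 := b7 i (v ∘ (e (i+1)).symm)
    have h1 : (∀ r, ∑ c, mat i (e i r) (e (i + 1) c) * v c = 0) ↔
        ∀ r, ∑ c, mat i r c * (v ∘ (e (i+1)).symm) c = 0 := by
      constructor
      · intro h r
        have := h ((e i).symm r)
        rw [← Equiv.sum_comp (e (i + 1))]
        simpa using this
      · intro h r
        have := h (e i r)
        rw [← Equiv.sum_comp (e (i + 1))] at this
        simpa using this
    rw [h1, h0]
    constructor
    · rintro ⟨w, hw⟩
      refine ⟨w ∘ e (i + 2), fun r => ?_⟩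
      have := hw (e (i + 1) r)
      rw [Function.comp_apply, Equiv.symm_apply_apply] at this
      rw [this, ← Equiv.sum_comp (e (i + 2))]
      rfl
    · rintro ⟨w, hw⟩
      refine ⟨w ∘ (e (i + 2)).symm, fun r => ?_⟩
      rw [Function.comp_apply, hw, ← Equiv.sum_comp (e (i + 2))]
      simp
  · intro i r
    have := (b2 i (e i r)).2
    show (tw i (e i r)).toNat ≤ _
    omega
end

end C6

namespace C6
universe u
set_option linter.unusedSectionVars false
set_option linter.unusedVariables false
open ZG

section
variable {σ : Type} {K : Type u} [Field K]

/-- division by a variable -/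
noncomputable def D (z : σ) (p : MvPolynomial σ K) : MvPolynomial σ K := divMonomial p (Finsupp.single z 1)

/-- remainder on division by a variable -/
noncomputable def ep (z : σ) (p : MvPolynomial σ K) : MvPolynomial σ K := p - X z * D z p

theorem D_add (z : σ) (p q : MvPolynomial σ K) : D z (p + q) = D z p + D z q := add_divMonomial _ _ _
theorem D_zero (z : σ) : D z (0 : MvPolynomial σ K) = 0 := zero_divMonomial _
theorem D_neg (z : σ) (p : MvPolynomial σ K) : D z (-p) = - D z p := by
  have := D_add z p (-p)
  rw [add_neg_cancel, D_zero] at this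
  exact (neg_eq_of_add_eq_zero_right this.symm).symm
theorem D_sub (z : σ) (p q : MvPolynomial σ K) : D z (p - q) = D z p - D z q := by
  rw [sub_eq_add_neg, D_add, D_neg, sub_eq_add_neg]
theorem D_X (z : σ) (p : MvPolynomial σ K) : D z (X z * p) = p := X_mul_divMonomial _ _
theorem coeff_D (z : σ) (p : MvPolynomial σ K) (e : σ →₀ ℕ) :
    coeff e (D z p) = coeff (Finsupp.single z 1 + e) p := coeff_divMonomial _ _ _
theorem D_sum {ι : Type*} (s : Finset ι) (z : σ) (p : ι → MvPolynomial σ K) :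
    D z (∑ i ∈ s, p i) = ∑ i ∈ s, D z (p i) := by
  classical
  induction s using Finset.induction_on with
  | empty => simp [D_zero]
  | insert a s ha ih => rw [Finset.sum_insert ha, Finset.sum_insert ha, D_add, ih]

theorem D_comm (z w : σ) (p : MvPolynomial σ K) : D z (D w p) = D w (D z p) := by
  ext e
  rw [coeff_D, coeff_D, coeff_D, coeff_D, add_left_comm]

theorem D_nil (z : σ) (p : MvPolynomial σ K) : ∃ n, (D z)^[n] p = 0 := by
  have key : ∀ n, ∀ e, coeff e ((D z)^[n] p) = coeff (Finsupp.single z n + e) p := by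
    intro n
    induction n with
    | zero => intro e; simp
    | succ n ih =>
      intro e
      rw [Function.iterate_succ_apply', coeff_D, ih, ← add_assoc, ← Finsupp.single_add]
  refine ⟨p.totalDegree + 1, ?_⟩
  ext e
  rw [key, coeff_zero]
  apply coeff_eq_zero_of_totalDegree_lt
  have : (Finsupp.single z (p.totalDegree + 1) + e).degree = p.totalDegree + 1 + e.degree := by
    rw [map_add, Finsupp.degree_single]
  have h2 : (Finsupp.single z (p.totalDegree + 1) + e).degree =
    ∑ i ∈ (Finsupp.single z (p.totalDegree + 1) + e).support, (Finsupp.single z (p.totalDegree + 1) + e) i := rfl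
  omega

theorem D_ep (z : σ) (p : MvPolynomial σ K) : D z (ep z p) = 0 := by
  rw [ep, D_sub, D_X, sub_self]

theorem ep_of_D {z : σ} {p : MvPolynomial σ K} (h : D z p = 0) : ep z p = p := by
  rw [ep, h]; simp

theorem ep_X (z : σ) (p : MvPolynomial σ K) : ep z (X z * p) = 0 := by
  rw [ep, D_X, sub_self]

theorem ep_add (z : σ) (p q : MvPolynomial σ K) : ep z (p + q) = ep z p + ep z q := by
  rw [ep, ep, ep, D_add]; ring

theorem ep_sum {ι : Type*} (s : Finset ι) (z : σ) (p : ι → MvPolynomial σ K) :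
    ep z (∑ i ∈ s, p i) = ∑ i ∈ s, ep z (p i) := by
  simp only [ep, D_sum, Finset.sum_sub_distrib, Finset.mul_sum]

def Lin (z : σ) (g : MvPolynomial σ K) : Prop := ∀ p, D z (g * p) = g * D z p

theorem Lin.X {z w : σ} (h : w ≠ z) : Lin z (X w : MvPolynomial σ K) := by
  classical
  intro p
  ext e
  rw [coeff_D, coeff_X_mul', coeff_X_mul', coeff_D]
  have h1 : (w ∈ (Finsupp.single z 1 + e).support) ↔ w ∈ e.support := by
    simp [h.symm]
  by_cases h2 : w ∈ e.support
  · rw [if_pos h2, if_pos (h1.2 h2)]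
    congr 1
    have : Finsupp.single w 1 ≤ e := by
      rw [Finsupp.single_le_iff]
      rw [Finsupp.mem_support_iff] at h2
      omega
    rw [add_tsub_assoc_of_le this]
  · rw [if_neg h2, if_neg (mt h1.1 h2)]

theorem Lin.mul {z : σ} {f g : MvPolynomial σ K} (hf : Lin z f) (hg : Lin z g) : Lin z (f * g) := by
  intro p; rw [mul_assoc, hf, hg, mul_assoc]

theorem Lin.sub {z : σ} {f g : MvPolynomial σ K} (hf : Lin z f) (hg : Lin z g) : Lin z (f - g) := by
  intro p; rw [sub_mul, D_sub, hf, hg, sub_mul]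

theorem Lin.ep {z : σ} {f : MvPolynomial σ K} (hf : Lin z f) (p) : ep z (f * p) = f * C6.ep z p := by
  rw [C6.ep, C6.ep, hf]; ring

def Zfree (z : σ) (B : Ideal (MvPolynomial σ K)) : Prop := ∀ p ∈ B, D z p ∈ B

theorem Zfree.bot (z : σ) : Zfree z (⊥ : Ideal (MvPolynomial σ K)) := by
  intro p hp
  rw [Ideal.mem_bot] at hp ⊢
  rw [hp, D_zero]

theorem Zfree.sup {z : σ} {A B : Ideal (MvPolynomial σ K)} (hA : Zfree z A) (hB : Zfree z B) :
    Zfree z (A ⊔ B) := by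
  intro p hp
  obtain ⟨a, ha, b, hb, rfl⟩ := Submodule.mem_sup.1 hp
  rw [D_add]
  exact Submodule.add_mem_sup (hA a ha) (hB b hb)

theorem Zfree.span {z : σ} {s : Set (MvPolynomial σ K)} (h : ∀ g ∈ s, Lin z g) :
    Zfree z (Ideal.span s) := by
  intro p hp
  have : ∀ a, D z (a * p) ∈ Ideal.span s := by
    induction hp using Submodule.span_induction with
    | mem x hx =>
      intro a
      rw [mul_comm, h x hx]
      exact Ideal.mul_mem_right _ _ (Ideal.subset_span hx)
    | zero => intro a; rw [mul_zero, D_zero]; exact zero_mem _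
    | add x y _ _ hx hy => intro a; rw [mul_add, D_add]; exact add_mem (hx a) (hy a)
    | smul b x _ hx => intro a; rw [smul_eq_mul, ← mul_assoc]; exact hx _
  have := this 1
  rwa [one_mul] at this

theorem Zfree.single {z : σ} {g : MvPolynomial σ K} (h : Lin z g) : Zfree z (Ideal.span {g}) :=
  Zfree.span (by rintro _ rfl; exact h)

theorem Zfree.ep {z : σ} {B : Ideal (MvPolynomial σ K)} (h : Zfree z B) {p} (hp : p ∈ B) : ep z p ∈ B :=
  sub_mem hp (Ideal.mul_mem_left _ _ (h p hp))

def Nzd (f : MvPolynomial σ K) (B : Ideal (MvPolynomial σ K)) : Prop := ∀ q, f * q ∈ B → q ∈ B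

theorem Zfree.nzd {z : σ} {B : Ideal (MvPolynomial σ K)} (h : Zfree z B) : Nzd (MvPolynomial.X z) B := by
  intro q hq
  have := h _ hq
  rwa [D_X] at this

theorem Nzd.mul {f g : MvPolynomial σ K} {B} (hf : Nzd f B) (hg : Nzd g B) : Nzd (f * g) B := by
  intro q hq
  rw [mul_assoc] at hq
  exact hg _ (hf _ hq)

/-- attach: if `f` is nzd mod `I` and `h` nzd mod `I + f` then `f` nzd mod `I + h`. -/
theorem Nzd.swap {f h : MvPolynomial σ K} {I} (hf : Nzd f I) (hh : Nzd h (I ⊔ Ideal.span {f})) :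
    Nzd f (I ⊔ Ideal.span {h}) := by
  intro q hq
  obtain ⟨i, hi, c, hc, e⟩ := Submodule.mem_sup.1 hq
  obtain ⟨r, rfl⟩ := Ideal.mem_span_singleton'.1 hc
  have h1 : h * r ∈ I ⊔ Ideal.span {f} := by
    have : h * r = -i + q * f := by rw [mul_comm q, ← e]; ring
    rw [this]
    exact Submodule.add_mem_sup (neg_mem hi) (Ideal.mem_span_singleton'.2 ⟨q, rfl⟩)
  obtain ⟨j, hj, d, hd, e2⟩ := Submodule.mem_sup.1 (hh _ h1)
  obtain ⟨s, rfl⟩ := Ideal.mem_span_singleton'.1 hd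
  have h2 : q - s * h ∈ I := by
    apply hf
    have : f * (q - s * h) = i + h * j := by rw [mul_sub, ← e, ← e2]; ring
    rw [this]
    exact add_mem hi (Ideal.mul_mem_left _ _ hj)
  have : q = (q - s * h) + s * h := by ring
  rw [this]
  exact Submodule.add_mem_sup h2 (Ideal.mem_span_singleton'.2 ⟨s, rfl⟩)

theorem Nzd.addVar {f : MvPolynomial σ K} {I} (hf : Nzd f I) {z : σ} (hz : Zfree z I) (hfz : Lin z f) :
    Nzd f (I ⊔ Ideal.span {MvPolynomial.X z}) :=
  hf.swap (Zfree.nzd (hz.sup (Zfree.single hfz)))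

theorem Nzd.bot {f : MvPolynomial σ K} (hf : f ≠ 0) : Nzd f ⊥ := by
  intro q hq
  rw [Ideal.mem_bot] at hq ⊢
  exact (mul_eq_zero.1 hq).resolve_left hf

/-- regularity after killing a nonzerodivisor -/
theorem RegQ.nzd {f : MvPolynomial σ K} {k : ℤ} (hf : f ∈ hd k) (hk : 1 ≤ k) {B} (hB : IsH B)
    (h : Nzd f B) {m m' : ℤ} (hr : RegQ ⊤ B 0 m) (hm : m + k ≤ m' + 1) :
    RegQ ⊤ (B ⊔ Ideal.span {f}) 0 m' := by
  refine RegQ.quot (f := f) (A := ⊤) (A' := ⊤) (B := B) (B' := B) hf IsH.top hB (fun _ _ => trivial) ?_ ?_ hr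
    (hr.mono le_rfl (by omega)) (by omega) hm
  · intro a _
    exact ⟨h a, fun h => Ideal.mul_mem_left _ _ h⟩
  · rw [Ideal.mul_top]

theorem RegQ.inter {I I1 I2 : Ideal (MvPolynomial σ K)} (h : IsH I) (h1 : IsH I1) (h2 : IsH I2)
    (i1 : I ≤ I1) (i2 : I ≤ I2) (i3 : I1 ⊓ I2 ≤ I) {m : ℤ} (r1 : RegQ ⊤ I1 0 m) (r2 : RegQ ⊤ I2 0 m)
    (r3 : RegQ ⊤ (I1 ⊔ I2) 0 (m - 1)) : RegQ ⊤ I 0 m := by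
  have a1 := RegQ.ker (f := (1 : MvPolynomial σ K)) (A := ⊤) (A' := I2) (B := I1) (B' := I1) (B'' := I1 ⊔ I2) hd_one h2 h1
    (fun _ _ => trivial) (fun a _ => by rw [one_mul]) (by rw [Ideal.span_singleton_one, Ideal.top_mul])
    (hi := m - 1) (lo := 0) (by simpa using r1) r3
  refine RegQ.ext (f := (1 : MvPolynomial σ K)) (A := ⊤) (A' := I2) (B := I) (B' := I1) (B'' := I2) hd_one h2 h
    (fun _ _ => trivial) ?_ ?_ a1 r2 (by omega) (by omega)
  · intro a ha
    rw [one_mul]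
    exact ⟨fun h => i1 h, fun h => i3 ⟨h, ha⟩⟩
  · rw [Ideal.span_singleton_one, Ideal.top_mul, sup_eq_right.2 i2]
end

end C6

namespace C6
universe u
set_option linter.unusedSectionVars false
set_option linter.unusedVariables false
open ZG

section
variable {V : Type} [DecidableEq V] {K : Type u} [Field K]

noncomputable abbrev xx (v : V) : MvPolynomial (V ⊕ V) K := X (Sum.inl v)
noncomputable abbrev yy (v : V) : MvPolynomial (V ⊕ V) K := X (Sum.inr v)
noncomputable def ff (u v : V) : MvPolynomial (V ⊕ V) K := xx u * yy v - xx v * yy u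

theorem ff_hd (u v : V) : (ff u v : MvPolynomial (V ⊕ V) K) ∈ hd 2 :=
  sub_mem (hd_mul (hd_X _) (hd_X _)) (hd_mul (hd_X _) (hd_X _))

theorem ff_self (u : V) : (ff u u : MvPolynomial (V ⊕ V) K) = 0 := by simp [ff]
theorem ff_symm (u v : V) : (ff u v : MvPolynomial (V ⊕ V) K) = - ff v u := by simp [ff]

theorem ff_linl {u v w : V} (h1 : u ≠ w) (h2 : v ≠ w) : Lin (Sum.inl w) (ff u v : MvPolynomial (V ⊕ V) K) := by
  refine (Lin.mul (Lin.X ?_) (Lin.X ?_)).sub (Lin.mul (Lin.X ?_) (Lin.X ?_)) <;> simp [h1, h2]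

theorem ff_linr {u v w : V} (h1 : u ≠ w) (h2 : v ≠ w) : Lin (Sum.inr w) (ff u v : MvPolynomial (V ⊕ V) K) := by
  refine (Lin.mul (Lin.X ?_) (Lin.X ?_)).sub (Lin.mul (Lin.X ?_) (Lin.X ?_)) <;> simp [h1, h2]

def VFree (w : V) (B : Ideal (MvPolynomial (V ⊕ V) K)) : Prop := Zfree (Sum.inl w) B ∧ Zfree (Sum.inr w) B

theorem VFree.bot (w : V) : VFree w (⊥ : Ideal (MvPolynomial (V ⊕ V) K)) := ⟨Zfree.bot _, Zfree.bot _⟩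

theorem VFree.sup {w : V} {A B : Ideal (MvPolynomial (V ⊕ V) K)} (hA : VFree w A) (hB : VFree w B) :
    VFree w (A ⊔ B) := ⟨hA.1.sup hB.1, hA.2.sup hB.2⟩

theorem VFree.ff {u v w : V} (h1 : u ≠ w) (h2 : v ≠ w) :
    VFree w (Ideal.span {(C6.ff u v : MvPolynomial (V ⊕ V) K)}) :=
  ⟨Zfree.single (ff_linl h1 h2), Zfree.single (ff_linr h1 h2)⟩

/-- complete graph ideal -/
noncomputable def KK (K : Type u) [Field K] (N : Finset V) : Ideal (MvPolynomial (V ⊕ V) K) :=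
  Ideal.span {p | ∃ i ∈ N, ∃ j ∈ N, p = ff i j}

/-- star ideal -/
noncomputable def FN (K : Type u) [Field K] (w : V) (N : Finset V) : Ideal (MvPolynomial (V ⊕ V) K) :=
  Ideal.span ((fun j => ff w j) '' (N : Set V))

theorem mem_FN {w : V} {N : Finset V} {p : MvPolynomial (V ⊕ V) K} :
    p ∈ FN K w N ↔ ∃ r : V → MvPolynomial (V ⊕ V) K, p = ∑ j ∈ N, r j * ff w j := by
  rw [FN, Ideal.span, Submodule.mem_span_image_finset_iff_exists_fun']
  simp only [smul_eq_mul, eq_comm]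

theorem ff_mem_FN {w j : V} {N : Finset V} (h : j ∈ N) : ff w j ∈ FN K w N :=
  Ideal.subset_span ⟨j, h, rfl⟩

theorem ff_mem_KK {i j : V} {N : Finset V} (hi : i ∈ N) (hj : j ∈ N) : ff i j ∈ KK K N :=
  Ideal.subset_span ⟨i, hi, j, hj, rfl⟩

theorem KK_le {N : Finset V} {I : Ideal (MvPolynomial (V ⊕ V) K)} (h : ∀ i ∈ N, ∀ j ∈ N, ff i j ∈ I) :
    KK K N ≤ I := by
  rw [KK, Ideal.span_le]
  rintro _ ⟨i, hi, j, hj, rfl⟩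
  exact h i hi j hj

theorem FN_le {w : V} {N : Finset V} {I : Ideal (MvPolynomial (V ⊕ V) K)} (h : ∀ j ∈ N, ff w j ∈ I) :
    FN K w N ≤ I := by
  rw [FN, Ideal.span_le]
  rintro _ ⟨j, hj, rfl⟩
  exact h j hj

theorem KK_mono {N N' : Finset V} (h : N ⊆ N') : KK K N ≤ KK K N' :=
  KK_le fun i hi j hj => ff_mem_KK (h hi) (h hj)

theorem KK_insert (w : V) (N : Finset V) : KK K (insert w N) = KK K N ⊔ FN K w N := by
  apply le_antisymm
  · apply KK_le
    intro i hi j hj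
    rw [Finset.mem_insert] at hi hj
    rcases hi with rfl | hi
    · rcases hj with rfl | hj
      · rw [ff_self]; exact zero_mem _
      · exact Submodule.mem_sup_right (ff_mem_FN hj)
    · rcases hj with rfl | hj
      · rw [ff_symm]; exact neg_mem (Submodule.mem_sup_right (ff_mem_FN hi))
      · exact Submodule.mem_sup_left (ff_mem_KK hi hj)
  · refine sup_le (KK_mono (Finset.subset_insert _ _)) (FN_le fun j hj => ?_)
    exact ff_mem_KK (Finset.mem_insert_self _ _) (Finset.mem_insert_of_mem hj)

theorem KK_small (v : V) : KK K {v} = ⊥ := by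
  rw [eq_bot_iff]
  apply KK_le
  intro i hi j hj
  rw [Finset.mem_singleton] at hi hj
  rw [hi, hj, ff_self]; exact zero_mem _

theorem KK_isH (N : Finset V) : IsH (KK K N) :=
  IsH.span (by rintro _ ⟨i, _, j, _, rfl⟩; exact ⟨2, ff_hd i j⟩)

theorem FN_isH (w : V) (N : Finset V) : IsH (FN K w N) :=
  IsH.span (by rintro _ ⟨i, _, rfl⟩; exact ⟨2, ff_hd w i⟩)

theorem KK_free {w : V} {N : Finset V} (h : w ∉ N) : VFree w (KK K N) := by
  constructor
  · apply Zfree.span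
    rintro _ ⟨i, hi, j, hj, rfl⟩
    exact ff_linl (fun e => h (e ▸ hi)) (fun e => h (e ▸ hj))
  · apply Zfree.span
    rintro _ ⟨i, hi, j, hj, rfl⟩
    exact ff_linr (fun e => h (e ▸ hi)) (fun e => h (e ▸ hj))

/-- the edge `w j` with `w` a new vertex gives a nonzerodivisor -/
theorem nzd_ff {B : Ideal (MvPolynomial (V ⊕ V) K)} {w j : V} (hw : VFree w B) (hj : Nzd (xx j) B) (hwj : j ≠ w) :
    Nzd (ff w j) B := by
  have main : ∀ n, ∀ q : MvPolynomial (V ⊕ V) K, (D (Sum.inl w))^[n] q = 0 → ff w j * q ∈ B → q ∈ B := by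
    intro n
    induction n with
    | zero => intro q h _; rw [Function.iterate_zero_apply] at h; rw [h]; exact zero_mem _
    | succ n ih =>
      intro q h hq
      have e0 : ff w j * q = xx w * (yy j * q) - (xx j * yy w) * q := by rw [ff]; ring
      have lx : Lin (Sum.inl w) (xx j * yy w : MvPolynomial (V ⊕ V) K) :=
        Lin.mul (Lin.X (by simp [hwj])) (Lin.X (by simp))
      have h1 : D (Sum.inl w) (ff w j * q) = yy j * q - (xx j * yy w) * D (Sum.inl w) q := by
        rw [e0, D_sub, D_X, lx]
      have h2 := hw.1.ep hq
      have h3 : ep (Sum.inl w) (ff w j * q) = xx j * (yy w * (- ep (Sum.inl w) q)) := by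
        rw [ep, h1, ep, ff]; ring
      rw [h3] at h2
      have h4 := hw.2.nzd _ (hj _ h2)
      have h4 : ep (Sum.inl w) q ∈ B := by simpa using neg_mem h4
      have h5 : D (Sum.inl w) q ∈ B := by
        apply ih _ (by rwa [Function.iterate_succ_apply] at h)
        apply hw.1.nzd
        have : X (Sum.inl w) * (ff w j * D (Sum.inl w) q) = ff w j * q - ff w j * ep (Sum.inl w) q := by
          rw [ep]; ring
        rw [this]
        exact sub_mem hq (Ideal.mul_mem_left _ _ h4)
      have : q = ep (Sum.inl w) q + X (Sum.inl w) * D (Sum.inl w) q := by rw [ep]; ring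
      rw [this]
      exact add_mem h4 (Ideal.mul_mem_left _ _ h5)
  intro q hq
  obtain ⟨n, hn⟩ := D_nil (Sum.inl w) q
  exact main n q hn hq

theorem nzd_simplicial {B : Ideal (MvPolynomial (V ⊕ V) K)} {w : V} {N : Finset V} (hw : VFree w B) (hN : w ∉ N)
    (hB : KK K N ≤ B) (hj : ∀ j ∈ N, Nzd (xx j) B) : Nzd (xx w) (B ⊔ FN K w N) := by
  intro p hp
  obtain ⟨c, hc, s, hs, e⟩ := Submodule.mem_sup.1 hp
  obtain ⟨r, rfl⟩ := mem_FN.1 hs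
  set z : V ⊕ V := Sum.inl w
  have ne : ∀ j ∈ N, j ≠ w := fun j hj h => hN (h ▸ hj)
  have d1 : ∀ j ∈ N, D z (r j * ff w j) = yy j * ep z (r j) + D z (r j) * ff w j := by
    intro j hj
    have lx : Lin z (xx j * yy w : MvPolynomial (V ⊕ V) K) :=
        Lin.mul (Lin.X (by simp [z, ne j hj])) (Lin.X (by simp [z]))
    have e0 : r j * ff w j = xx w * (yy j * r j) - (xx j * yy w) * r j := by rw [ff]; ring
    rw [e0, D_sub, D_X, lx, ep, ff]; ring
  have d2 : ∀ j ∈ N, ep z (r j * ff w j) = - yy w * (xx j * ep z (r j)) := by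
    intro j hj
    rw [ep, d1 j hj, ep, ff]; ring
  have e1 : p = D z c + (∑ j ∈ N, yy j * ep z (r j)) + ∑ j ∈ N, D z (r j) * ff w j := by
    have := congrArg (D z) e
    rw [D_X, D_add, D_sum, Finset.sum_congr rfl d1, Finset.sum_add_distrib] at this
    rw [← this]; ring
  have e2 : ∑ j ∈ N, xx j * ep z (r j) ∈ B := by
    have := congrArg (ep z) e
    rw [ep_X, ep_add, ep_sum, Finset.sum_congr rfl d2, ← Finset.mul_sum] at this
    apply hw.2.nzd
    have h2 : X (Sum.inr w) * ∑ j ∈ N, xx j * ep z (r j) = ep z c := by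
      linear_combination (-1 : MvPolynomial (V ⊕ V) K) * this
    rw [h2]
    exact hw.1.ep hc
  have e3 : ∑ j ∈ N, yy j * ep z (r j) ∈ B := by
    rcases N.eq_empty_or_nonempty with rfl | ⟨k, hk⟩
    · simp
    · apply hj k hk
      have : xx k * ∑ j ∈ N, yy j * ep z (r j) = (∑ j ∈ N, ff k j * ep z (r j)) + yy k * ∑ j ∈ N, xx j * ep z (r j) := by
        rw [Finset.mul_sum, Finset.mul_sum, ← Finset.sum_add_distrib]
        refine Finset.sum_congr rfl fun j _ => ?_
        rw [ff]; ring
      rw [this]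
      refine add_mem (sum_mem fun j hj => Ideal.mul_mem_right _ _ (hB (ff_mem_KK hk hj))) (Ideal.mul_mem_left _ _ e2)
  rw [e1]
  exact Submodule.add_mem_sup (add_mem (hw.1 _ hc) e3) (mem_FN.2 ⟨_, rfl⟩)

theorem ohtani {B : Ideal (MvPolynomial (V ⊕ V) K)} {v : V} {N : Finset V} (hv : VFree v B) (hN : v ∉ N)
    {p : MvPolynomial (V ⊕ V) K} (h1 : p ∈ B ⊔ FN K v N ⊔ KK K N)
    (h2 : p ∈ B ⊔ Ideal.span {xx v} ⊔ Ideal.span {yy v}) : p ∈ B ⊔ FN K v N := by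
  obtain ⟨q, hq, δ, hδ, rfl⟩ := Submodule.mem_sup.1 h1
  refine add_mem hq ?_
  have kf := KK_free (K := K) hN
  have m1 : ∀ d ∈ KK K N, xx v * d ∈ FN K v N := by
    intro d hd
    induction hd using Submodule.span_induction with
    | mem x hx =>
      obtain ⟨i, hi, j, hj, rfl⟩ := hx
      have : (xx v : MvPolynomial (V ⊕ V) K) * ff i j = xx i * ff v j - xx j * ff v i := by simp only [ff]; ring
      rw [this]
      exact sub_mem (Ideal.mul_mem_left _ _ (ff_mem_FN hj)) (Ideal.mul_mem_left _ _ (ff_mem_FN hi))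
    | zero => rw [mul_zero]; exact zero_mem _
    | add x y _ _ hx hy => rw [mul_add]; exact add_mem hx hy
    | smul b x _ hx => rw [smul_eq_mul, mul_left_comm]; exact Ideal.mul_mem_left _ _ hx
  have m2 : ∀ d ∈ KK K N, yy v * d ∈ FN K v N := by
    intro d hd
    induction hd using Submodule.span_induction with
    | mem x hx =>
      obtain ⟨i, hi, j, hj, rfl⟩ := hx
      have : (yy v : MvPolynomial (V ⊕ V) K) * ff i j = yy i * ff v j - yy j * ff v i := by simp only [ff]; ring
      rw [this]
      exact sub_mem (Ideal.mul_mem_left _ _ (ff_mem_FN hj)) (Ideal.mul_mem_left _ _ (ff_mem_FN hi))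
    | zero => rw [mul_zero]; exact zero_mem _
    | add x y _ _ hx hy => rw [mul_add]; exact add_mem hx hy
    | smul b x _ hx => rw [smul_eq_mul, mul_left_comm]; exact Ideal.mul_mem_left _ _ hx
  set a := ep (Sum.inl v) δ with ha
  have ha1 : a ∈ KK K N := kf.1.ep hδ
  set b := ep (Sum.inr v) a with hb
  have hb1 : b ∈ KK K N := kf.2.ep ha1
  have c1 : δ - a ∈ FN K v N := by
    have : δ - a = xx v * D (Sum.inl v) δ := by rw [ha, ep]; ring
    rw [this]; exact m1 _ (kf.1 _ hδ)
  have c2 : a - b ∈ FN K v N := by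
    have : a - b = yy v * D (Sum.inr v) a := by rw [hb, ep]; ring
    rw [this]; exact m2 _ (kf.2 _ ha1)
  have c3 : δ - b ∈ FN K v N := by
    have := add_mem c1 c2
    rwa [sub_add_sub_cancel] at this
  have hF : FN K v N ≤ Ideal.span {xx v} ⊔ Ideal.span {yy v} := by
    apply FN_le
    intro j _
    have : (C6.ff v j : MvPolynomial (V ⊕ V) K) = yy j * xx v + (- xx j) * yy v := by rw [ff]; ring
    rw [this]
    exact Submodule.add_mem_sup (Ideal.mul_mem_left _ _ (Ideal.mem_span_singleton_self _)) (Ideal.mul_mem_left _ _ (Ideal.mem_span_singleton_self _))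
  have hb2 : b ∈ B ⊔ Ideal.span {xx v} ⊔ Ideal.span {yy v} := by
    have hFB : B ⊔ FN K v N ≤ B ⊔ Ideal.span {xx v} ⊔ Ideal.span {yy v} := by
      rw [sup_assoc]; exact sup_le_sup_left hF _
    have h3 := sub_mem h2 (hFB hq)
    rw [add_sub_cancel_left] at h3
    have h4 := sub_mem h3 (hFB (Submodule.mem_sup_right c3))
    rwa [sub_sub_cancel] at h4
  have Da : D (Sum.inl v) b = 0 := by
    have lx : Lin (Sum.inl v) (yy v : MvPolynomial (V ⊕ V) K) := Lin.X (by simp)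
    rw [hb, ep, D_sub, lx, D_comm, ha, D_ep, D_zero]; simp
  have Db : D (Sum.inr v) b = 0 := by rw [hb, D_ep]
  obtain ⟨s, hs, t, ht, e⟩ := Submodule.mem_sup.1 hb2
  obtain ⟨β, hβ, s', hs', e'⟩ := Submodule.mem_sup.1 hs
  obtain ⟨g, rfl⟩ := Ideal.mem_span_singleton'.1 hs'
  obtain ⟨h, rfl⟩ := Ideal.mem_span_singleton'.1 ht
  have : b = ep (Sum.inr v) (ep (Sum.inl v) β) := by
    have lx : Lin (Sum.inl v) (yy v : MvPolynomial (V ⊕ V) K) := Lin.X (by simp)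
    have h1 : ep (Sum.inl v) b = b := ep_of_D Da
    have h2 : ep (Sum.inr v) b = b := ep_of_D Db
    have h3 := congrArg (fun z => ep (Sum.inr v) (ep (Sum.inl v) z)) e
    rw [h1, h2] at h3
    rw [← h3, ← e', mul_comm h, mul_comm g, ep_add, ep_add, ep_add, ep_X, add_zero, lx.ep, ep_X, add_zero]
  have hbB : b ∈ B := by
    rw [this]; exact hv.2.ep (hv.1.ep hβ)
  have : δ = b + (δ - b) := by ring
  rw [this]
  exact Submodule.add_mem_sup hbB c3

end

end C6

namespace C6
universe u
set_option linter.unusedSectionVars false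
set_option linter.unusedVariables false
open ZG

section
variable {V : Type} [DecidableEq V] {K : Type u} [Field K]

theorem nzd_KK (N : Finset V) (j : V) : Nzd (xx j) (KK K N) := by
  induction hn : N.card generalizing N j with
  | zero =>
    have : N = ∅ := Finset.card_eq_zero.1 hn
    subst this
    exact (KK_free (by simp)).1.nzd
  | succ n ih =>
    by_cases hj : j ∈ N
    · have e := Finset.insert_erase hj
      have h2 : (N.erase j).card = n := by rw [Finset.card_erase_of_mem hj, hn]; rfl
      rw [← e, KK_insert]
      exact nzd_simplicial (KK_free (by simp)) (by simp) le_rfl (fun i _ => ih _ _ h2)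
    · exact (KK_free hj).1.nzd

/-- ideal of x variables -/
noncomputable def PX (K : Type u) [Field K] (N : Finset V) : Ideal (MvPolynomial (V ⊕ V) K) :=
  Ideal.span ((fun j => xx j) '' (N : Set V))

theorem PX_isH (N : Finset V) : IsH (PX K N) :=
  IsH.span (by rintro _ ⟨i, _, rfl⟩; exact ⟨1, hd_X _⟩)

theorem PX_reg (N : Finset V) : RegQ ⊤ (PX K N) 0 0 := by
  induction N using Finset.induction_on with
  | empty => 
    have : PX K (∅ : Finset V) = ⊥ := by simp [PX]
    rw [this]; exact RegQ.base
  | insert w N hw ih =>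
    have : PX K (insert w N) = PX K N ⊔ Ideal.span {xx w} := by
      rw [PX, PX, Finset.coe_insert, Set.image_insert_eq, Ideal.span_insert, sup_comm]
    rw [this]
    refine RegQ.nzd (hd_X _) le_rfl (PX_isH N) (Zfree.nzd ?_) ih (by omega)
    apply Zfree.span
    rintro _ ⟨i, hi, rfl⟩
    apply Lin.X
    intro h
    apply hw
    rw [← Sum.inl_injective h]; exact hi

theorem KK_le_PX (N : Finset V) : KK K N ≤ PX K N := by
  apply KK_le
  intro i hi j hj
  rw [ff]
  exact sub_mem (Ideal.mul_mem_right _ _ (Ideal.subset_span ⟨i, hi, rfl⟩)) (Ideal.mul_mem_right _ _ (Ideal.subset_span ⟨j, hj, rfl⟩))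

theorem KK_reg (N : Finset V) : RegQ ⊤ (KK K N) 0 1 := by
  induction N using Finset.induction_on with
  | empty =>
    have : KK K (∅ : Finset V) = ⊥ := by
      rw [eq_bot_iff]; exact KK_le (by simp)
    rw [this]; exact RegQ.base.mono le_rfl (by omega)
  | insert w N hw ih =>
    rcases N.eq_empty_or_nonempty with rfl | ⟨j1, hj1⟩
    · rw [insert_empty_eq, KK_small]; exact RegQ.base.mono le_rfl (by omega)
    have hne : j1 ≠ w := fun h => hw (h ▸ hj1)
    set B := KK K N with hB
    set F := FN K w N with hF
    set P := PX K N with hP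
    set A : Ideal (MvPolynomial (V ⊕ V) K) := B ⊔ Ideal.span {xx j1} * F with hA
    have one_mul' : ∀ I : Ideal (MvPolynomial (V ⊕ V) K), Ideal.span {(1 : MvPolynomial (V ⊕ V) K)} * I = I := by
      intro I; rw [Ideal.span_singleton_one, Ideal.top_mul]
    have hPB : RegQ P B 0 1 := by
      have := RegQ.ker (f := (1 : MvPolynomial (V ⊕ V) K)) (A := ⊤) (A' := P) (B := B) (B' := B) (B'' := P) hd_one (PX_isH N) (KK_isH N)
        (fun _ _ => trivial) (fun a _ => by rw [one_mul]) (by rw [one_mul', sup_eq_right.2 (KK_le_PX N)])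
        (hi := 0) (lo := 0) ih (PX_reg N)
      simpa using this
    have id1 : ∀ i, (xx i : MvPolynomial (V ⊕ V) K) * ff w j1 = xx j1 * ff w i - xx w * ff j1 i := by
      intro i; simp only [ff]; ring
    have hAB : RegQ A B 2 3 := by
      refine RegQ.ext (f := ff w j1) (A := A) (A' := P) (B := B) (B' := B) (ff_hd w j1) (PX_isH N) (KK_isH N) ?_ ?_ rfl hPB
        (RegQ.zero ?_ _ _) (by omega) (by omega)
      · intro a ha
        have : P ≤ Submodule.comap (LinearMap.mulLeft (MvPolynomial (V ⊕ V) K) (ff w j1)) A := by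
          rw [hP, PX, Ideal.span_le]
          rintro _ ⟨i, hi, rfl⟩
          show ff w j1 * xx i ∈ A
          rw [mul_comm, id1]
          exact sub_mem (Submodule.mem_sup_right (Ideal.mul_mem_mul (Ideal.mem_span_singleton_self _) (ff_mem_FN hi)))
            (Submodule.mem_sup_left (Ideal.mul_mem_left _ _ (ff_mem_KK hj1 hi)))
        exact this ha
      · intro a _
        exact ⟨nzd_ff (KK_free hw) (nzd_KK N j1) hne a, fun h => Ideal.mul_mem_left _ _ h⟩
      · refine sup_le le_sup_left ?_
        rw [Ideal.span_singleton_mul_le_iff]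
        intro z hz
        have : F ≤ Submodule.comap (LinearMap.mulLeft (MvPolynomial (V ⊕ V) K) (xx j1)) (B ⊔ Ideal.span {ff w j1} * P) := by
          rw [hF, FN, Ideal.span_le]
          rintro _ ⟨i, hi, rfl⟩
          show xx j1 * ff w i ∈ B ⊔ Ideal.span {ff w j1} * P
          have e : (xx j1 : MvPolynomial (V ⊕ V) K) * ff w i = xx w * ff j1 i + ff w j1 * xx i := by
            have := id1 i; linear_combination -this
          rw [e]
          exact Submodule.add_mem_sup (Ideal.mul_mem_left _ _ (ff_mem_KK hj1 hi)) (Ideal.mul_mem_mul (Ideal.mem_span_singleton_self _) (Ideal.subset_span ⟨i, hi, rfl⟩))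
        exact this hz
    have hFB : RegQ F B 1 2 := by
      have := RegQ.ker (f := xx j1) (k := 1) (A := A) (A' := F) (B := B) (B' := B) (hd_X _) (FN_isH w N) (KK_isH N)
        (fun a ha => Submodule.mem_sup_right (Ideal.mul_mem_mul (Ideal.mem_span_singleton_self _) ha)) 
        (fun a _ => ⟨nzd_KK N j1 a, fun h => Ideal.mul_mem_left _ _ h⟩) rfl (lo := 2) (hi := 2) hAB (RegQ.zero le_rfl _ _)
      simpa using this
    rw [KK_insert]
    exact RegQ.quot (f := (1 : MvPolynomial (V ⊕ V) K)) (A := ⊤) (A' := F) (B := B) (B' := B) (B'' := B ⊔ F) hd_one (FN_isH w N) (KK_isH N)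
        (fun _ _ => trivial) (fun a _ => by rw [one_mul]) (by rw [one_mul']) hFB ih (by omega) (by omega)

theorem tail_reg {B : Ideal (MvPolynomial (V ⊕ V) K)} {w c : V} {m : ℤ} (hB : IsH B) (hc : Nzd (xx c) B) (hw : VFree w B)
    (hr : RegQ ⊤ B 0 m) (h : c ≠ w) : RegQ ⊤ (B ⊔ Ideal.span {ff w c}) 0 (m + 1) :=
  RegQ.nzd (ff_hd w c) (by omega) hB (nzd_ff hw hc h) hr (by omega)

theorem tail_nzd {B : Ideal (MvPolynomial (V ⊕ V) K)} {w c : V} (hc : Nzd (xx c) B) (hw : VFree w B)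
    (h : c ≠ w) : Nzd (xx w) (B ⊔ Ideal.span {ff w c}) := by
  have : FN K w {c} = Ideal.span {ff w c} := by simp [FN]
  rw [← this]
  refine nzd_simplicial hw (by simpa using h.symm) (by rw [KK_small]; exact bot_le) ?_
  intro j hj
  rw [Finset.mem_singleton.1 hj]; exact hc

theorem addVar_reg {B : Ideal (MvPolynomial (V ⊕ V) K)} {v : V} {m : ℤ} (hB : IsH B) (hv : VFree v B)
    (hr : RegQ ⊤ B 0 m) : RegQ ⊤ (B ⊔ Ideal.span {xx v} ⊔ Ideal.span {yy v}) 0 m := by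
  refine RegQ.nzd (hd_X _) le_rfl (hB.sup (IsH.single (hd_X _))) (Zfree.nzd ?_) 
    (RegQ.nzd (m' := m) (hd_X _) le_rfl hB hv.1.nzd hr (by omega)) (by omega)
  exact hv.2.sup (Zfree.single (Lin.X (by simp)))

/-- The inductive step: regularity via the decomposition at a vertex `v` with clique-completed neighborhood. -/
theorem ohtani_reg {B : Ideal (MvPolynomial (V ⊕ V) K)} {v : V} {N : Finset V} {m : ℤ} (hB : IsH B) (hv : VFree v B) (hN : v ∉ N)
    (r1 : RegQ ⊤ (B ⊔ KK K (insert v N)) 0 m) (r2 : RegQ ⊤ B 0 m) (r3 : RegQ ⊤ (B ⊔ KK K N) 0 (m - 1)) :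
    RegQ ⊤ (B ⊔ FN K v N) 0 m := by
  have e1 : B ⊔ KK K (insert v N) = B ⊔ FN K v N ⊔ KK K N := by
    rw [KK_insert, sup_comm (KK K N), sup_assoc]
  have hF : FN K v N ≤ Ideal.span {xx v} ⊔ Ideal.span {yy v} := by
    apply FN_le
    intro j _
    have : (C6.ff v j : MvPolynomial (V ⊕ V) K) = yy j * xx v + (- xx j) * yy v := by rw [ff]; ring
    rw [this]
    exact Submodule.add_mem_sup (Ideal.mul_mem_left _ _ (Ideal.mem_span_singleton_self _)) (Ideal.mul_mem_left _ _ (Ideal.mem_span_singleton_self _))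
  have hFB : B ⊔ FN K v N ≤ B ⊔ Ideal.span {xx v} ⊔ Ideal.span {yy v} := by
    rw [sup_assoc]; exact sup_le_sup_left hF _
  refine RegQ.inter (I1 := B ⊔ FN K v N ⊔ KK K N) (I2 := B ⊔ Ideal.span {xx v} ⊔ Ideal.span {yy v})
    (hB.sup (FN_isH _ _)) ((hB.sup (FN_isH _ _)).sup (KK_isH _)) 
    ((hB.sup (IsH.single (hd_X _))).sup (IsH.single (hd_X _))) le_sup_left hFB ?_ (e1 ▸ r1) (addVar_reg hB hv r2) ?_
  · rintro p ⟨h1, h2⟩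
    exact ohtani hv hN h1 h2
  · have e2 : B ⊔ FN K v N ⊔ KK K N ⊔ (B ⊔ Ideal.span {xx v} ⊔ Ideal.span {yy v}) = B ⊔ KK K N ⊔ Ideal.span {xx v} ⊔ Ideal.span {yy v} := by
      apply le_antisymm
      · refine sup_le (sup_le (hFB.trans ?_) ?_) ?_
        · exact sup_le_sup_right (sup_le_sup_right le_sup_left _) _
        · exact (le_sup_right.trans le_sup_left).trans le_sup_left
        · exact sup_le_sup_right (sup_le_sup_right le_sup_left _) _
      · refine sup_le (sup_le (sup_le ?_ ?_) ?_) ?_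
        · exact (le_sup_left.trans le_sup_left).trans le_sup_right
        · exact le_sup_right.trans le_sup_left
        · exact (le_sup_right.trans le_sup_left).trans le_sup_right
        · exact le_sup_right.trans le_sup_right
    rw [e2]
    exact addVar_reg (hB.sup (KK_isH _)) (hv.sup (KK_free hN)) r3
end

end C6

namespace C6
universe u
set_option linter.unusedSectionVars false
set_option linter.unusedVariables false
open ZG

section
variable {K : Type u} [Field K]

def vx (j : ℕ) : Fin 6 := Fin.ofNat 6 j

theorem vx_inj {i j : ℕ} (hi : i < 6) (hj : j < 6) (h : vx i = vx j) : i = j := by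
  have := congrArg Fin.val h
  simp only [vx, Fin.val_ofNat] at this
  omega

/-- edge of the path -/
noncomputable def fe (K : Type u) [Field K] (j : ℕ) : MvPolynomial (Fin 6 ⊕ Fin 6) K := ff (vx (j+1)) (vx j)

/-- ideal of the path on the first j edges -/
noncomputable def bb (K : Type u) [Field K] : ℕ → Ideal (MvPolynomial (Fin 6 ⊕ Fin 6) K)
  | 0 => ⊥
  | (j+1) => bb K j ⊔ Ideal.span {fe K j}

theorem bb_isH (j : ℕ) : IsH (bb K j) := by
  induction j with
  | zero => exact IsH.bot
  | succ j ih => exact ih.sup (IsH.single (ff_hd _ _))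

theorem bb_free {i j : ℕ} (hij : j < i) (hi : i < 6) : VFree (vx i) (bb K j) := by
  induction j with
  | zero => exact VFree.bot _
  | succ j ih =>
    refine (ih (by omega)).sup (VFree.ff ?_ ?_)
    · intro h; have := vx_inj (by omega) hi h; omega
    · intro h; have := vx_inj (by omega) hi h; omega

/-- attaching the path to a base ideal at vertex `0` -/
theorem path_nzd {B : Ideal (MvPolynomial (Fin 6 ⊕ Fin 6) K)} {j : ℕ} (hj : j < 6) (h0 : Nzd (xx (vx 0)) B)
    (hf : ∀ i, 1 ≤ i → i ≤ j → VFree (vx i) B) : Nzd (xx (vx j)) (B ⊔ bb K j) := by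
  induction j with
  | zero => rw [bb, sup_bot_eq]; exact h0
  | succ j ih =>
    rw [bb, ← sup_assoc]
    refine tail_nzd (ih (by omega) (fun i h1 h2 => hf i h1 (by omega))) ((hf _ (by omega) le_rfl).sup (bb_free (by omega) hj)) ?_
    intro h; have := vx_inj (by omega) hj h; omega

theorem path_nzd_fe {B : Ideal (MvPolynomial (Fin 6 ⊕ Fin 6) K)} {j : ℕ} (hj : j + 1 < 6) (h0 : Nzd (xx (vx 0)) B)
    (hf : ∀ i, 1 ≤ i → i ≤ j + 1 → VFree (vx i) B) : Nzd (fe K j) (B ⊔ bb K j) := by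
  refine nzd_ff ((hf _ (by omega) le_rfl).sup (bb_free (by omega) hj)) (path_nzd (by omega) h0 (fun i h1 h2 => hf i h1 (by omega))) ?_
  intro h; have := vx_inj (by omega) hj h; omega

theorem path_reg {B : Ideal (MvPolynomial (Fin 6 ⊕ Fin 6) K)} {j : ℕ} (hj : j < 6) (hB : IsH B) (h0 : Nzd (xx (vx 0)) B)
    (hf : ∀ i, 1 ≤ i → i ≤ j → VFree (vx i) B) {m : ℤ} (hr : RegQ ⊤ B 0 m) : RegQ ⊤ (B ⊔ bb K j) 0 (m + j) := by
  induction j with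
  | zero => rw [bb, sup_bot_eq]; simpa using hr
  | succ j ih =>
    rw [bb, ← sup_assoc]
    refine RegQ.nzd (ff_hd _ _) (by omega) (hB.sup (bb_isH j)) (path_nzd_fe hj h0 hf) (ih (by omega) (fun i h1 h2 => hf i h1 (by omega))) ?_
    push_cast; omega

theorem bb_reg {j : ℕ} (hj : j < 6) : RegQ ⊤ (bb K j) 0 j := by
  have := path_reg (K := K) hj IsH.bot (Zfree.bot _).nzd (fun i _ _ => VFree.bot _) RegQ.base
  simpa using this

theorem bb_nzd {j : ℕ} (hj : j + 1 < 6) : Nzd (fe K j) (bb K j) := by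
  have := path_nzd_fe (K := K) hj (B := ⊥) (Zfree.bot _).nzd (fun i _ _ => VFree.bot _)
  simpa using this

/-- rewriting used in the induction steps -/
theorem step_eq (Q : Finset (Fin 6)) {j : ℕ} (hQ : vx (j+1) ∈ Q) :
    KK K Q ⊔ bb K (j+1) = (KK K (Q.erase (vx (j+1))) ⊔ bb K j) ⊔ FN K (vx (j+1)) (insert (vx j) (Q.erase (vx (j+1)))) := by
  have e : FN K (vx (j+1)) (insert (vx j) (Q.erase (vx (j+1)))) = FN K (vx (j+1)) (Q.erase (vx (j+1))) ⊔ Ideal.span {fe K j} := by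
    rw [FN, FN, Finset.coe_insert, Set.image_insert_eq, Ideal.span_insert, sup_comm]; rfl
  conv_lhs => rw [← Finset.insert_erase hQ, KK_insert, bb]
  rw [e]
  ac_rfl

theorem cliqueB {j : ℕ} (h1 : 1 ≤ j) (h6 : j < 6) (Q : Finset (Fin 6)) (hj : vx j ∈ Q) (h0 : vx 0 ∈ Q)
    (hQ : ∀ i, 1 ≤ i → i < j → vx i ∉ Q) : RegQ ⊤ (KK K Q ⊔ bb K j) 0 j := by
  induction j, h1 using Nat.le_induction generalizing Q with
  | base =>
    have : KK K Q ⊔ bb K 1 = KK K Q := by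
      rw [sup_eq_left, bb, bb, bot_sup_eq, Ideal.span_singleton_le_iff_mem]
      exact ff_mem_KK hj h0
    rw [this]; exact KK_reg Q
  | succ j hj1 ih =>
    have n1 : vx j ≠ vx (j+1) := by intro h; have := vx_inj (by omega) h6 h; omega
    have n0 : vx 0 ≠ vx (j+1) := by intro h; have := vx_inj (by omega) h6 h; omega
    have nv : ∀ i, i < j → vx i ≠ vx j := by intro i hi h; have := vx_inj (by omega) (by omega) h; omega
    rw [step_eq Q hj]
    set Q' := Q.erase (vx (j+1)) with hQ'
    have h0' : vx 0 ∈ Q' := Finset.mem_erase.2 ⟨n0, h0⟩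
    have habs : ∀ N : Finset (Fin 6), Q' ⊆ N → KK K Q' ⊔ bb K j ⊔ KK K N = KK K N ⊔ bb K j := by
      intro N hN
      rw [sup_right_comm, sup_eq_right.2 (KK_mono hN)]
    have hnot : ∀ i, 1 ≤ i → i < j + 1 → vx i ∉ Q' := fun i h1 h2 h => hQ i h1 h2 (Finset.mem_of_mem_erase h)
    refine ohtani_reg ((KK_isH _).sup (bb_isH _)) ((KK_free (by simp [hQ'])).sup (bb_free (by omega) h6)) ?_ ?_ ?_ ?_
    · simp [hQ', n1.symm]
    · rw [habs _ (fun x hx => by simp [hx])]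
      refine (ih (by omega) (insert (vx (j+1)) (insert (vx j) Q')) (by simp) (by simp [h0']) ?_).mono le_rfl (by push_cast; omega)
      intro i hi1 hi2
      simp only [Finset.mem_insert, not_or]
      refine ⟨?_, nv i hi2, hnot i hi1 (by omega)⟩
      intro h; have := vx_inj (by omega) h6 h; omega
    · refine (path_reg (by omega) (KK_isH _) (nzd_KK _ _) (fun i h1 h2 => KK_free (hnot i h1 (by omega))) (KK_reg _)).mono le_rfl ?_
      push_cast; omega
    · rw [habs _ (fun x hx => by simp [hx])]
      refine (ih (by omega) (insert (vx j) Q') (by simp) (by simp [h0']) ?_).mono le_rfl (by push_cast; omega)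
      intro i hi1 hi2
      simp only [Finset.mem_insert, not_or]
      exact ⟨nv i hi2, hnot i hi1 (by omega)⟩

theorem cycleA {j : ℕ} (h1 : 2 ≤ j) (h6 : j < 6) : RegQ ⊤ (KK K {vx j, vx 0} ⊔ bb K j) 0 ((j : ℤ) - 1) := by
  induction j, h1 using Nat.le_induction with
  | base =>
    have : KK K {vx 2, vx 0} ⊔ bb K 2 = KK K {vx 0, vx 1, vx 2} := by
      apply le_antisymm
      · refine sup_le (KK_mono (by decide)) ?_
        rw [bb, bb, bb, bot_sup_eq, sup_le_iff, Ideal.span_singleton_le_iff_mem, Ideal.span_singleton_le_iff_mem]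
        exact ⟨ff_mem_KK (by decide) (by decide), ff_mem_KK (by decide) (by decide)⟩
      · have e1 : fe K 0 ∈ KK K {vx 2, vx 0} ⊔ bb K 2 :=
          Submodule.mem_sup_right (Submodule.mem_sup_left (Submodule.mem_sup_right (Ideal.mem_span_singleton_self _)))
        have e2 : fe K 1 ∈ KK K {vx 2, vx 0} ⊔ bb K 2 :=
          Submodule.mem_sup_right (Submodule.mem_sup_right (Ideal.mem_span_singleton_self _))
        have e3 : ff (vx 2) (vx 0) ∈ KK K {vx 2, vx 0} ⊔ bb K 2 :=
          Submodule.mem_sup_left (ff_mem_KK (by decide) (by decide))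
        have e1' : ff (vx 0) (vx 1) ∈ KK K {vx 2, vx 0} ⊔ bb K 2 := by rw [ff_symm]; exact neg_mem e1
        have e2' : ff (vx 1) (vx 2) ∈ KK K {vx 2, vx 0} ⊔ bb K 2 := by rw [ff_symm]; exact neg_mem e2
        have e3' : ff (vx 0) (vx 2) ∈ KK K {vx 2, vx 0} ⊔ bb K 2 := by rw [ff_symm]; exact neg_mem e3
        apply KK_le
        intro i hi j hj
        simp only [Finset.mem_insert, Finset.mem_singleton] at hi hj
        rcases hi with rfl | rfl | rfl <;> rcases hj with rfl | rfl | rfl <;>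
          first | (rw [ff_self]; exact zero_mem _) | assumption
    rw [this]; exact KK_reg _
  | succ j hj1 ih =>
    have n1 : vx j ≠ vx (j+1) := by intro h; have := vx_inj (by omega) h6 h; omega
    have n0 : vx 0 ≠ vx (j+1) := by intro h; have := vx_inj (by omega) h6 h; omega
    rw [step_eq _ (by simp)]
    have eQ : Finset.erase ({vx (j+1), vx 0} : Finset (Fin 6)) (vx (j+1)) = {vx 0} := by
      rw [Finset.erase_insert]; simpa using n0.symm
    rw [eQ, KK_small, bot_sup_eq]
    refine ohtani_reg (bb_isH _) (bb_free (by omega) h6) ?_ ?_ ?_ ?_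
    · simp [n1.symm, n0.symm]
    · rw [sup_comm]
      refine (cliqueB (by omega) (by omega) (insert (vx (j+1)) {vx j, vx 0}) (by simp) (by simp) ?_).mono le_rfl (by push_cast; omega)
      intro i hi1 hi2
      simp only [Finset.mem_insert, Finset.mem_singleton, not_or]
      refine ⟨?_, ?_, ?_⟩ <;> (intro h; have := vx_inj (by omega) (by omega) h; omega)
    · exact (bb_reg (by omega)).mono le_rfl (by push_cast; omega)
    · rw [sup_comm]
      exact (ih (by omega)).mono le_rfl (by push_cast; omega)

/-- the closing edge -/
noncomputable def gg (K : Type u) [Field K] : MvPolynomial (Fin 6 ⊕ Fin 6) K := ff (vx 0) (vx 5)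

noncomputable def JJ (K : Type u) [Field K] : Ideal (MvPolynomial (Fin 6 ⊕ Fin 6) K) := bb K 5 ⊔ Ideal.span {gg K}

theorem JJ_isH : IsH (JJ K) := (bb_isH _).sup (IsH.single (ff_hd _ _))

theorem JJ_reg : RegQ ⊤ (JJ K) 0 4 := by
  have h := cycleA (K := K) (j := 5) (by omega) (by omega)
  have : KK K {vx 5, vx 0} = Ideal.span {gg K} := by
    rw [KK_insert, KK_small, bot_sup_eq, FN, Finset.coe_singleton, Set.image_singleton, gg, ff_symm, Ideal.span_singleton_neg]
  rw [this, sup_comm] at h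
  exact h

end

end C6

namespace C6
universe u
set_option linter.unusedSectionVars false
set_option linter.unusedVariables false
open ZG

section
variable {K : Type u} [Field K]

def MM (j : ℕ) : Finset (Fin 6) := (Finset.Icc j 5).image vx

theorem MM_succ {j : ℕ} (hj : j ≤ 5) : MM j = insert (vx j) (MM (j+1)) := by
  rw [MM, MM, ← Finset.image_insert]
  congr 1
  ext i; simp only [Finset.mem_Icc, Finset.mem_insert]; omega

theorem mem_MM {i j : ℕ} (hi : j ≤ i) (h : i ≤ 5) : vx i ∈ MM j :=
  Finset.mem_image.2 ⟨i, Finset.mem_Icc.2 ⟨hi, h⟩, rfl⟩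

theorem notMem_MM {i j : ℕ} (hi : i < j) (h : i ≤ 5) : vx i ∉ MM j := by
  intro hh
  obtain ⟨k, hk, e⟩ := Finset.mem_image.1 hh
  rw [Finset.mem_Icc] at hk
  have := vx_inj (by omega) (by omega) e
  omega

/-- `gg` is a nonzerodivisor once the cycle is cut -/
theorem gg_nzd {k i : ℕ} (hk : k ≤ 5) (hik : i < k) : Nzd (gg K) (KK K (MM k) ⊔ bb K i) := by
  have n50 : vx 5 ≠ vx 0 := by decide
  have f0 : VFree (vx 0) (KK K (MM k)) := KK_free (notMem_MM (by omega) (by omega))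
  have h0 : Nzd (gg K) (KK K (MM k)) := nzd_ff f0 (nzd_KK _ _) n50
  have hx0 : Nzd (xx (vx 0)) (KK K (MM k) ⊔ Ideal.span {gg K}) := tail_nzd (nzd_KK _ _) f0 n50
  induction i with
  | zero => rw [bb, sup_bot_eq]; exact h0
  | succ i ih =>
    rw [bb, ← sup_assoc]
    refine (ih (by omega)).swap ?_
    rw [sup_right_comm]
    refine path_nzd_fe (by omega) hx0 ?_
    intro l h1 h2
    refine (KK_free (notMem_MM (by omega) (by omega))).sup (VFree.ff ?_ ?_) <;>
      (intro h; have := vx_inj (by omega) (by omega) h; omega)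

theorem lat_aux {α : Type*} [Lattice α] {a b d f : α} (h : a ≤ d) : a ⊔ b ⊔ f ⊔ d = d ⊔ f ⊔ b := by
  have : d = a ⊔ d := (sup_eq_right.2 h).symm
  conv_rhs => rw [this]
  ac_rfl

theorem colonP {j : ℕ} (hj : j ≤ 4) (q : MvPolynomial (Fin 6 ⊕ Fin 6) K)
    (h : gg K * (gg K * q) ∈ KK K (MM j) ⊔ bb K j) : gg K * q ∈ KK K (MM j) ⊔ bb K j := by
  induction j generalizing q with
  | zero => exact Submodule.mem_sup_left (Ideal.mul_mem_right _ _ (ff_mem_KK (mem_MM (by omega) (by omega)) (mem_MM (by omega) (by omega))))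
  | succ j ih =>
    have hn := notMem_MM (i := j+1) (j := j+2) (by omega) (by omega)
    have hn' := notMem_MM (i := j) (j := j+2) (by omega) (by omega)
    have n1 : vx (j+1) ≠ vx j := by intro h; have := vx_inj (by omega) (by omega) h; omega
    have e0 : (MM (j+1)).erase (vx (j+1)) = MM (j+2) := by
      rw [MM_succ (by omega), Finset.erase_insert hn]
    have e := step_eq (K := K) (MM (j+1)) (j := j) (mem_MM le_rfl (by omega))
    rw [e0] at e
    rw [e] at h ⊢
    set B := KK K (MM (j+2)) ⊔ bb K j with hB
    set N := insert (vx j) (MM (j+2)) with hN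
    have hvf : VFree (vx (j+1)) B := (KK_free hn).sup (bb_free (by omega) (by omega))
    have hvN : vx (j+1) ∉ N := by simp [hN, hn, n1]
    have e1 : B ⊔ FN K (vx (j+1)) N ⊔ KK K N = KK K (MM j) ⊔ bb K j := by
      have : MM j = insert (vx (j+1)) N := by
        rw [MM_succ (by omega), MM_succ (j := j+1) (by omega), hN, Finset.insert_comm]
      rw [this, KK_insert (vx (j+1)) N, hB]
      have hle : KK K (MM (j+2)) ≤ KK K N := KK_mono (by rw [hN]; exact Finset.subset_insert _ _)
      exact lat_aux (a := KK K (MM (j+2))) (b := bb K j) (d := KK K N) (f := FN K (vx (j+1)) N) hle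
    have hFB : B ⊔ FN K (vx (j+1)) N ≤ B ⊔ Ideal.span {xx (vx (j+1))} ⊔ Ideal.span {yy (vx (j+1))} := by
      rw [sup_assoc B]; apply sup_le_sup_left
      apply FN_le
      intro i _
      have : (C6.ff (vx (j+1)) i : MvPolynomial (Fin 6 ⊕ Fin 6) K) = yy i * xx (vx (j+1)) + (- xx i) * yy (vx (j+1)) := by rw [ff]; ring
      rw [this]
      exact Submodule.add_mem_sup (Ideal.mul_mem_left _ _ (Ideal.mem_span_singleton_self _)) (Ideal.mul_mem_left _ _ (Ideal.mem_span_singleton_self _))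
    refine ohtani hvf hvN ?_ ?_
    · rw [e1]
      refine ih (by omega) q ?_
      rw [← e1]
      exact Submodule.mem_sup_left h
    · have n0 : vx 0 ≠ vx (j+1) := by intro h; have := vx_inj (by omega) (by omega) h; omega
      have n5 : vx 5 ≠ vx (j+1) := by intro h; have := vx_inj (by omega) (by omega) h; omega
      have g1 : Nzd (gg K) B := gg_nzd (by omega) (by omega)
      have g2 := g1.addVar hvf.1 (ff_linl n0 n5)
      have g3 := g2.addVar (hvf.2.sup (Zfree.single (Lin.X (by simp)))) (ff_linr n0 n5)
      exact g3 _ (hFB h)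

theorem colon (q : MvPolynomial (Fin 6 ⊕ Fin 6) K) (h : gg K * (gg K * q) ∈ bb K 5) : gg K * q ∈ bb K 5 := by
  have : bb K 5 = KK K (MM 4) ⊔ bb K 4 := by
    have : MM 4 = {vx 5, vx 4} := by decide
    rw [this, KK_insert, KK_small, bot_sup_eq, FN, Finset.coe_singleton, Set.image_singleton, bb, sup_comm]; rfl
  rw [this] at h ⊢
  exact colonP le_rfl q h

theorem colon_pow (n : ℕ) (q : MvPolynomial (Fin 6 ⊕ Fin 6) K) (h : gg K ^ (n+1) * q ∈ bb K 5) : gg K * q ∈ bb K 5 := by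
  induction n generalizing q with
  | zero => simpa using h
  | succ n ih =>
    apply colon
    apply ih
    rw [pow_succ, mul_assoc] at h
    exact h

theorem bb_le_succ (j : ℕ) : bb K j ≤ bb K (j+1) := by rw [bb]; exact le_sup_left

theorem bb_mono {i j : ℕ} (h : i ≤ j) : bb K i ≤ bb K j := monotone_nat_of_le_succ bb_le_succ h

theorem fe_mem {j : ℕ} (h : j < 5) : fe K j ∈ JJ K :=
  Submodule.mem_sup_left (bb_mono (i := j+1) (by omega) (by rw [bb]; exact Submodule.mem_sup_right (Ideal.mem_span_singleton_self _)))

theorem gg_mem : gg K ∈ JJ K := Submodule.mem_sup_right (Ideal.mem_span_singleton_self _)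

theorem JJ_pow (s : ℕ) : JJ K ^ (s+1) = bb K 5 * JJ K ^ s ⊔ Ideal.span {gg K ^ (s+1)} := by
  have hJ : JJ K = bb K 5 ⊔ Ideal.span {gg K} := rfl
  induction s with
  | zero => simp [← hJ]
  | succ s ih =>
    apply le_antisymm
    · rw [pow_succ' (JJ K) (s+1)]
      conv_lhs => rw [hJ, Ideal.sup_mul, ← hJ]
      refine sup_le le_sup_left ?_
      rw [ih, Ideal.mul_sup]
      refine sup_le ?_ ?_
      · refine le_trans ?_ le_sup_left
        rw [mul_left_comm, ← ih]
        refine Ideal.mul_mono_right ?_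
        rw [pow_succ']
        refine Ideal.mul_mono_left ?_
        rw [hJ]; exact le_sup_right
      · rw [Ideal.span_singleton_mul_span_singleton, ← pow_succ']
        exact le_sup_right
    · refine sup_le ?_ ?_
      · rw [pow_succ' (JJ K) (s+1)]
        exact Ideal.mul_mono_left le_sup_left
      · rw [Ideal.span_singleton_le_iff_mem]
        exact Ideal.pow_mem_pow gg_mem _

theorem inter_a (s : ℕ) {p : MvPolynomial (Fin 6 ⊕ Fin 6) K} (h1 : p ∈ bb K 5) (h2 : p ∈ JJ K ^ (s+1)) :
    p ∈ bb K 5 * JJ K ^ s := by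
  rw [JJ_pow] at h2
  obtain ⟨v, hv, w, hw, rfl⟩ := Submodule.mem_sup.1 h2
  obtain ⟨c, rfl⟩ := Ideal.mem_span_singleton'.1 hw
  refine add_mem hv ?_
  have h3 := sub_mem h1 (Ideal.mul_le_left hv)
  rw [add_sub_cancel_left, mul_comm] at h3
  have h4 := colon_pow _ _ h3
  have e : c * gg K ^ (s+1) = (gg K * c) * gg K ^ s := by ring
  rw [e]
  exact Ideal.mul_mem_mul h4 (Ideal.pow_mem_pow gg_mem _)

theorem inter_b {j : ℕ} (hj : j ≤ 5) : ∀ (s : ℕ) {p : MvPolynomial (Fin 6 ⊕ Fin 6) K} (h1 : p ∈ bb K j) (h2 : p ∈ JJ K ^ (s+1)),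
    p ∈ bb K j * JJ K ^ s := by
  induction hj using Nat.decreasingInduction with
  | self => intro s p h1 h2; exact inter_a s h1 h2
  | of_succ j hj ih =>
    intro s
    induction s with
    | zero => intro p h1 h2; simpa using h1
    | succ s ihs =>
      intro p h1 h2
      have h3 := ih (s+1) (bb_le_succ j h1) h2
      rw [bb, Ideal.sup_mul] at h3
      obtain ⟨v, hv, w, hw, rfl⟩ := Submodule.mem_sup.1 h3
      obtain ⟨z, hz, rfl⟩ := Ideal.mem_span_singleton_mul.1 hw
      refine add_mem hv ?_
      have h4 := sub_mem h1 (Ideal.mul_le_left hv)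
      rw [add_sub_cancel_left] at h4
      have h5 := ihs (bb_nzd (by omega) _ h4) hz
      rw [pow_succ', mul_left_comm]
      exact Ideal.mul_mem_mul (fe_mem (by omega)) h5

theorem regU (s : ℕ) : ∀ j ≤ 5, RegQ (JJ K ^ (s+1)) (bb K j * JJ K ^ s) 0 (2 * s + 5) := by
  have one_mul' : ∀ I : Ideal (MvPolynomial (Fin 6 ⊕ Fin 6) K), Ideal.span {(1 : MvPolynomial (Fin 6 ⊕ Fin 6) K)} * I = I := by
      intro I; rw [Ideal.span_singleton_one, Ideal.top_mul]
  induction s with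
  | zero =>
    intro j hj
    have hle : bb K j ≤ JJ K := (bb_mono hj).trans le_sup_left
    have := RegQ.ker (f := (1 : MvPolynomial (Fin 6 ⊕ Fin 6) K)) (A := ⊤) (A' := JJ K) (B := bb K j) (B' := bb K j) (B'' := JJ K) hd_one JJ_isH (bb_isH j)
      (fun _ _ => trivial) (fun a _ => by rw [one_mul]) (by rw [one_mul', sup_eq_right.2 hle])
      (hi := 4) (lo := 0) ((bb_reg (by omega)).mono le_rfl (by omega)) JJ_reg
    simpa using this
  | succ s ih =>
    have h0 := ih 0
    have hJ1 : RegQ (JJ K) (bb K 5) 0 5 := by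
      have := RegQ.ker (f := (1 : MvPolynomial (Fin 6 ⊕ Fin 6) K)) (A := ⊤) (A' := JJ K) (B := bb K 5) (B' := bb K 5) (B'' := JJ K) hd_one JJ_isH (bb_isH 5)
        (fun _ _ => trivial) (fun a _ => by rw [one_mul]) (by rw [one_mul', sup_eq_right.2 (show bb K 5 ≤ JJ K from le_sup_left)])
        (hi := 4) (lo := 0) ((bb_reg (by omega)).mono le_rfl (by omega)) JJ_reg
      simpa using this
    intro j hj
    induction hj using Nat.decreasingInduction with
    | self =>
      have hgd : (gg K ^ (s+1)) ∈ hd (2 * ((s : ℤ) + 1)) := by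
        have : (gg K ^ (s+1)).IsHomogeneous (2 * (s+1)) := ((hd_nat (n := 2)).1 (ff_hd _ _)).pow _
        have h2 := (hd_nat (n := 2 * (s+1))).2 this
        simpa using h2
      refine RegQ.ext (f := gg K ^ (s+1)) (A := JJ K ^ (s+1+1)) (A' := JJ K) (B := bb K 5 * JJ K ^ (s+1)) (B' := bb K 5) hgd
        JJ_isH ((bb_isH _).mul (JJ_isH.pow _)) ?_ ?_ rfl hJ1 (RegQ.zero ?_ _ _) (by omega) (by push_cast; omega)
      · intro x hx
        rw [pow_succ]; exact Ideal.mul_mem_mul (Ideal.pow_mem_pow gg_mem _) hx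
      · intro x hx
        constructor
        · intro h
          obtain ⟨v, hv, w, hw, rfl⟩ := Submodule.mem_sup.1 (show x ∈ bb K 5 ⊔ Ideal.span {gg K} from hx)
          obtain ⟨c, rfl⟩ := Ideal.mem_span_singleton'.1 hw
          refine add_mem hv ?_
          have h1 := sub_mem (Ideal.mul_le_left h) (Ideal.mul_mem_left _ (gg K ^ (s+1)) hv)
          rw [mul_comm c]
          apply colon_pow (s+1)
          convert h1 using 1
          ring
        · intro h
          rw [mul_comm (gg K ^ (s+1)) x]; exact Ideal.mul_mem_mul h (Ideal.pow_mem_pow gg_mem _)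
      · rw [JJ_pow]
        refine sup_le_sup_left ?_ _
        rw [Ideal.span_singleton_le_iff_mem, pow_succ]
        exact Ideal.mul_mem_mul (Ideal.mem_span_singleton_self _) gg_mem
    | of_succ j hj ihj =>
      refine RegQ.ext (f := fe K j) (A := JJ K ^ (s+1+1)) (A' := JJ K ^ (s+1)) (B := bb K j * JJ K ^ (s+1)) (B' := bb K j * JJ K ^ s) (ff_hd _ _)
        (JJ_isH.pow _) ((bb_isH _).mul (JJ_isH.pow _)) ?_ ?_ ?_ (ih j (by omega)) ihj (by omega) (by push_cast; omega)
      · intro x hx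
        rw [pow_succ' _ (s+1)]; exact Ideal.mul_mem_mul (fe_mem hj) hx
      · intro x hx
        constructor
        · intro h
          exact inter_b (by omega) s (bb_nzd (by omega) _ (Ideal.mul_le_left h)) hx
        · intro h
          rw [pow_succ', mul_left_comm]
          exact Ideal.mul_mem_mul (fe_mem hj) h
      · rw [bb, Ideal.sup_mul]

theorem reg_upper (s : ℕ) : RegQ ⊤ (JJ K ^ (s+1)) 0 (2 * s + 4) := by
  have h := regU (K := K) s 0 (by omega)
  have e : bb K 0 * JJ K ^ s = ⊥ := by rw [bb, Ideal.bot_mul]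
  rw [e] at h
  refine RegQ.quot (f := (1 : MvPolynomial (Fin 6 ⊕ Fin 6) K)) (A := ⊤) (A' := JJ K ^ (s+1)) (B := ⊥) (B' := ⊥) hd_one (JJ_isH.pow _) IsH.bot
        (fun _ _ => trivial) (fun a _ => by rw [one_mul]) (by rw [Ideal.span_singleton_one, Ideal.top_mul, bot_sup_eq]) h
        (RegQ.base.mono le_rfl (by omega)) (by omega) (by omega)

theorem JJ_eq : JJ K = binomialEdgeIdeal K (SimpleGraph.cycleGraph 6) := by
  apply le_antisymm
  · have key : ∀ u v : Fin 6, (SimpleGraph.cycleGraph 6).Adj u v → ff u v ∈ binomialEdgeIdeal K (SimpleGraph.cycleGraph 6) :=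
      fun u v h => Ideal.subset_span ⟨u, v, h, rfl⟩
    refine sup_le ?_ ?_
    · rw [bb, bb, bb, bb, bb, bb]
      simp only [bot_sup_eq, sup_le_iff, Ideal.span_singleton_le_iff_mem]
      refine ⟨⟨⟨⟨?_, ?_⟩, ?_⟩, ?_⟩, ?_⟩ <;> exact key _ _ (by decide)
    · rw [Ideal.span_singleton_le_iff_mem]
      exact key _ _ (by decide)
  · rw [binomialEdgeIdeal, Ideal.span_le]
    rintro _ ⟨u, v, h, rfl⟩
    show ff u v ∈ JJ K
    have h0 := fe_mem (K := K) (j := 0) (by omega)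
    have h1 := fe_mem (K := K) (j := 1) (by omega)
    have h2 := fe_mem (K := K) (j := 2) (by omega)
    have h3 := fe_mem (K := K) (j := 3) (by omega)
    have h4 := fe_mem (K := K) (j := 4) (by omega)
    have h5 := gg_mem (K := K)
    have key : ∀ u v : Fin 6, (SimpleGraph.cycleGraph 6).Adj u v → 
      (∃ j < 5, (u = vx (j+1) ∧ v = vx j) ∨ (v = vx (j+1) ∧ u = vx j)) ∨ (u = vx 0 ∧ v = vx 5) ∨ (v = vx 0 ∧ u = vx 5) := by decide
    rcases key u v h with ⟨j, hj, ⟨rfl, rfl⟩ | ⟨rfl, rfl⟩⟩ | ⟨rfl, rfl⟩ | ⟨rfl, rfl⟩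
    · exact fe_mem hj
    · rw [ff_symm]; exact neg_mem (fe_mem hj)
    · exact gg_mem
    · rw [ff_symm]; exact neg_mem gg_mem

theorem upper_final (s : ℕ) : ∃ F : GradedFreeResolution (binomialEdgeIdeal K (SimpleGraph.cycleGraph 6) ^ (s+1)),
    ∀ (i : ℕ) (r : Fin (F.rk i)), F.tw i r ≤ (2 * s + 4) + i := by
  apply conv
  rw [← JJ_eq]
  have := reg_upper (K := K) s
  exact_mod_cast this
end

end C6

namespace C6
universe u
set_option linter.unusedSectionVars false
set_option linter.unusedVariables false
open ZG

section
variable {K : Type u} [Field K]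

/-- coordinatewise division by a variable -/
noncomputable def DD {σ : Type} {n : ℕ} (z : σ) (v : Fin n → MvPolynomial σ K) : Fin n → MvPolynomial σ K := fun r => D z (v r)

theorem DD_add {σ : Type} {n : ℕ} (z : σ) (v w : Fin n → MvPolynomial σ K) : DD z (v + w) = DD z v + DD z w :=
  funext fun r => D_add z _ _

theorem DD_X {σ : Type} {n : ℕ} (z : σ) (v : Fin n → MvPolynomial σ K) : DD z ((X z : MvPolynomial σ K) • v) = v :=
  funext fun r => D_X z _

theorem DD_ne {σ : Type} {n : ℕ} {z w : σ} (h : w ≠ z) (v : Fin n → MvPolynomial σ K) :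
    DD z ((X w : MvPolynomial σ K) • v) = (X w : MvPolynomial σ K) • DD z v :=
  funext fun r => Lin.X h _

theorem vec_const {n : ℕ} (v : Fin n → MvPolynomial (Fin 4) K) (h : ∀ r, constantCoeff (v r) = 0) :
    ∃ α β γ δ : Fin n → MvPolynomial (Fin 4) K, v = (X 0 : MvPolynomial (Fin 4) K) • α + (X 1 : MvPolynomial (Fin 4) K) • β
      + (X 2 : MvPolynomial (Fin 4) K) • γ + (X 3 : MvPolynomial (Fin 4) K) • δ := by
  have : ∀ r, ∃ c : Fin 4 → MvPolynomial (Fin 4) K, ∑ i, c i * X i = v r := by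
    intro r
    rw [← Ideal.mem_span_range_iff_exists_fun, ← Set.image_univ, mem_ideal_span_X_image]
    intro m hm
    by_contra hc
    push Not at hc
    have : m = 0 := Finsupp.ext fun i => hc i trivial
    rw [this, mem_support_iff] at hm
    exact hm (h r)
  choose c hc using this
  refine ⟨fun r => c r 0, fun r => c r 1, fun r => c r 2, fun r => c r 3, ?_⟩
  funext r
  rw [← hc r, Fin.sum_univ_four]
  simp only [Pi.add_apply, Pi.smul_apply, smul_eq_mul]
  ring

local notation "R4" => MvPolynomial (Fin 4) K

theorem chase {n0 n1 n2 n3 n4 : ℕ}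
    (D0 : (Fin n1 → R4) →ₗ[R4] (Fin n0 → R4)) (D1 : (Fin n2 → R4) →ₗ[R4] (Fin n1 → R4))
    (D2 : (Fin n3 → R4) →ₗ[R4] (Fin n2 → R4)) (D3 : (Fin n4 → R4) →ₗ[R4] (Fin n3 → R4))
    (h01 : ∀ w, D0 (D1 w) = 0) (h12 : ∀ w, D1 (D2 w) = 0) (h23 : ∀ w, D2 (D3 w) = 0)
    {a b c d : R4} (ha : a = X 0) (hb : b = X 1) (hc : c = X 2) (hd : d = X 3)
    (P0 : Fin n0 → R4) (P1 P2 : Fin n1 → R4) (P12 P13 P23 : Fin n2 → R4) (P123 P124 P134 P234 : Fin n3 → R4) (P : Fin n4 → R4)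
    (e1 : D0 P1 = (a ^ 2) • P0) (e12 : D1 P12 = (a ^ 2) • P2 - (b ^ 2 - c * a) • P1)
    (e123 : D2 P123 = (a ^ 2) • P23 - (b ^ 2 - c * a) • P13 + (c ^ 2 - d * b) • P12)
    (e1234 : D3 P = (a ^ 2) • P234 - (b ^ 2 - c * a) • P134 + (c ^ 2 - d * b) • P124 - (d ^ 2) • P123)
    (hP : ∀ r, constantCoeff (P r) = 0) : ∃ w, D0 w = (a * b * c * d) • P0 := by
  obtain ⟨α, β, γ, δ, hα⟩ := vec_const P hP
  rw [← ha, ← hb, ← hc, ← hd] at hα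
  rw [hα] at e1234
  simp only [map_add, map_smul] at e1234
  have s1 : d • (D3 δ + d • P123) = a • (a • P234 + c • P134 - D3 α) + b • (-(b • P134) - d • P124 - D3 β) + c • (c • P124 - D3 γ) := by
    linear_combination (norm := module) e1234
  have s1' := congrArg (DD (3 : Fin 4)) s1
  rw [hd, DD_X, DD_add, DD_add, ha, hb, hc, DD_ne (by decide), DD_ne (by decide), DD_ne (by decide), ← ha, ← hb, ← hc, ← hd] at s1'
  generalize DD 3 (a • P234 + c • P134 - D3 α) = A at s1'
  generalize DD 3 (-(b • P134) - d • P124 - D3 β) = B at s1'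
  generalize DD 3 (c • P124 - D3 γ) = C at s1'
  have t1 := congrArg D2 s1'
  simp only [map_add, map_smul, h23, e123] at t1
  have s2 : c • ((d * c) • P12 - D2 C) = a • (D2 A - (d * a) • P23 - (d * c) • P13) + b • (D2 B + (d * b) • P13 + (d * d) • P12) := by
    linear_combination (norm := module) t1
  have s2' := congrArg (DD (2 : Fin 4)) s2
  rw [hc, DD_X, DD_add, ha, hb, DD_ne (by decide), DD_ne (by decide), ← ha, ← hb, ← hc] at s2'
  generalize DD 2 (D2 A - (d * a) • P23 - (d * c) • P13) = A' at s2'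
  generalize DD 2 (D2 B + (d * b) • P13 + (d * d) • P12) = B' at s2'
  have t2 := congrArg D1 s2'
  simp only [map_add, map_sub, map_smul, h12, e12] at t2
  have s3 : b • (-((d * c * b) • P1) - D1 B') = a • (D1 A' - (d * c * a) • P2 - (d * c * c) • P1) := by
    linear_combination (norm := module) t2
  have s3' := congrArg (DD (1 : Fin 4)) s3
  rw [hb, DD_X, ha, DD_ne (by decide), ← ha, ← hb] at s3'
  generalize DD 1 (D1 A' - (d * c * a) • P2 - (d * c * c) • P1) = A'' at s3'
  have t3 := congrArg D0 s3'
  simp only [map_neg, map_sub, map_smul, h01, e1] at t3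
  have s4 : a • (-((d * c * b * a) • P0)) = a • D0 A'' := by
    linear_combination (norm := module) t3
  have s4' := congrArg (DD (0 : Fin 4)) s4
  rw [ha, DD_X, DD_X, ← ha] at s4'
  refine ⟨- A'', ?_⟩
  rw [map_neg, ← s4']
  module

end

end C6

namespace C6
universe u
set_option linter.unusedSectionVars false
set_option linter.unusedVariables false
open ZG

section
variable {K : Type u} [Field K]

/-- weights of the functional detecting the socle element -/
def ww (K : Type u) [Field K] (t : ℕ) (e : Fin 4 →₀ ℕ) : K :=
  (if 3 * e 0 + 2 * e 1 + e 2 = 6 * t ∧ e 1 + 2 * e 2 + 3 * e 3 = 6 then 1 else 0)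
    - (if e 0 = 2 * t ∧ e 1 = 0 ∧ e 2 = 0 ∧ e 3 = 2 then 1 else 0)

noncomputable def lam (K : Type u) [Field K] (t : ℕ) : MvPolynomial (Fin 4) K →ₗ[K] K :=
  (basisMonomials (Fin 4) K).constr K (ww K t)

theorem lam_mono (t : ℕ) (e : Fin 4 →₀ ℕ) : lam K t (monomial e 1) = ww K t e := by
  have := (basisMonomials (Fin 4) K).constr_basis K (ww K t) e
  simpa [lam] using this

theorem lam_kill {t : ℕ} {g : MvPolynomial (Fin 4) K} (h : ∀ e, lam K t (g * monomial e 1) = 0) (q) : lam K t (g * q) = 0 := by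
  have : (lam K t) ∘ₗ (LinearMap.mulLeft K g) = 0 := by
    apply (basisMonomials (Fin 4) K).ext
    intro e
    simpa using h e
  exact LinearMap.congr_fun this q

theorem Xpow (i : Fin 4) (n : ℕ) : (X i : MvPolynomial (Fin 4) K) ^ n = monomial (Finsupp.single i n) 1 := X_pow_eq_monomial

theorem mono_mul (e f : Fin 4 →₀ ℕ) : (monomial e (1:K)) * monomial f 1 = monomial (e + f) 1 := by simp [monomial_mul]

theorem kill1 (t : ℕ) (q) : lam K t (X 0 ^ (2 * t) * q) = 0 := by
  apply lam_kill
  intro e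
  rw [Xpow, mono_mul, lam_mono, ww, sub_eq_zero]
  simp [Finsupp.single_apply]
  refine if_congr ?_ rfl rfl
  omega

theorem kill2 (t : ℕ) (q) : lam K t ((X 1 ^ 2 - X 2 * X 0) * q) = 0 := by
  apply lam_kill
  intro e
  rw [← pow_one (X 2), ← pow_one (X 0), sub_mul, mul_assoc, Xpow, Xpow, Xpow, mono_mul, mono_mul, mono_mul, map_sub, lam_mono, lam_mono, ww, ww, sub_eq_zero]
  congr 1
  · simp [Finsupp.single_apply]
    refine if_congr ?_ rfl rfl
    omega
  · simp [Finsupp.single_apply]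

theorem kill3 (t : ℕ) (q) : lam K t ((X 2 ^ 2 - X 3 * X 1) * q) = 0 := by
  apply lam_kill
  intro e
  rw [← pow_one (X 3), ← pow_one (X 1), sub_mul, mul_assoc, Xpow, Xpow, Xpow, mono_mul, mono_mul, mono_mul, map_sub, lam_mono, lam_mono, ww, ww, sub_eq_zero]
  congr 1
  · simp [Finsupp.single_apply]
    refine if_congr ?_ rfl rfl
    omega
  · simp [Finsupp.single_apply]

theorem kill4 (t : ℕ) (q) : lam K t (X 3 ^ 2 * q) = 0 := by
  apply lam_kill
  intro e
  rw [Xpow, mono_mul, lam_mono, ww, sub_eq_zero]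
  simp [Finsupp.single_apply]
  refine if_congr ?_ rfl rfl
  omega

theorem lam_one (s : ℕ) : lam K (s+1) (X 0 ^ (2 * s) * (X 0 * X 1 * X 2 * X 3)) = 1 := by
  have : (X 0 ^ (2 * s) * (X 0 * X 1 * X 2 * X 3) : MvPolynomial (Fin 4) K) =
      monomial (Finsupp.single 0 (2 * s + 1) + Finsupp.single 1 1 + Finsupp.single 2 1 + Finsupp.single 3 1) 1 := by
    rw [← mono_mul, ← mono_mul, ← mono_mul, ← Xpow, ← Xpow, ← Xpow, ← Xpow]; ring
  rw [this, lam_mono, ww]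
  simp [Finsupp.single_apply]
  omega

theorem sup_pow_le {R : Type*} [CommRing R] (I J : Ideal R) (n : ℕ) : (I ⊔ J) ^ n ≤ I ^ n ⊔ J := by
  induction n with
  | zero => simp
  | succ n ih =>
    rw [pow_succ, pow_succ]
    refine (Ideal.mul_mono_left ih).trans ?_
    rw [Ideal.sup_mul, Ideal.mul_sup]
    refine sup_le (sup_le_sup_left Ideal.mul_le_right _) (le_sup_of_le_right Ideal.mul_le_left)

theorem not_mem (s : ℕ) : X 0 ^ (2 * s) * (X 0 * X 1 * X 2 * X 3) ∉
    (Ideal.span {X 0 ^ 2} ⊔ (Ideal.span {X 1 ^ 2 - X 2 * X 0} ⊔ Ideal.span {X 2 ^ 2 - X 3 * X 1} ⊔ Ideal.span {X 3 ^ 2}) :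
      Ideal (MvPolynomial (Fin 4) K)) ^ (s+1) := by
  intro h
  have h := sup_pow_le _ _ _ h
  rw [Ideal.span_singleton_pow, ← pow_mul] at h
  obtain ⟨p, hp, q, hq, e⟩ := Submodule.mem_sup.1 h
  obtain ⟨q', hq', q3, hq3, rfl⟩ := Submodule.mem_sup.1 hq
  obtain ⟨q1, hq1, q2, hq2, rfl⟩ := Submodule.mem_sup.1 hq'
  obtain ⟨p, rfl⟩ := Ideal.mem_span_singleton.1 hp
  obtain ⟨q1, rfl⟩ := Ideal.mem_span_singleton.1 hq1
  obtain ⟨q2, rfl⟩ := Ideal.mem_span_singleton.1 hq2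
  obtain ⟨q3, rfl⟩ := Ideal.mem_span_singleton.1 hq3
  have := congrArg (lam K (s+1)) e
  rw [lam_one, map_add, map_add, map_add, kill1, kill2, kill3, kill4] at this
  simp at this

/-- the specialization -/
noncomputable def rho (K : Type u) [Field K] : MvPolynomial (Fin 6 ⊕ Fin 6) K →ₐ[K] MvPolynomial (Fin 4) K :=
  aeval (Sum.elim ![X 0, X 1, X 2, X 3, 0, 0] ![0, X 0, X 1, X 2, X 3, 0])

theorem rho_const (p : MvPolynomial (Fin 6 ⊕ Fin 6) K) : constantCoeff (rho K p) = constantCoeff p := by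
  have : (constantCoeff (R := K)).comp (rho K).toRingHom = constantCoeff := by
    apply MvPolynomial.ringHom_ext
    · intro r; simp [rho]
    · rintro (i | i) <;> fin_cases i <;> simp [rho]
  exact RingHom.congr_fun this p

theorem rho_ff (u v : Fin 6) : rho K (ff u v) = (rho K (xx u)) * rho K (yy v) - rho K (xx v) * rho K (yy u) := by
  simp [ff]

theorem vx_one : vx 1 = (1 : Fin 6) := rfl

theorem rho0 : rho K (ff (vx 0) (vx 1)) = X 0 ^ 2 := by
  rw [rho_ff, vx_one]; simp [rho, vx]; ring
theorem rho1 : rho K (ff (vx 1) (vx 2)) = X 1 ^ 2 - X 2 * X 0 := by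
  rw [rho_ff, vx_one]; simp [rho, vx]; ring
theorem rho2 : rho K (ff (vx 2) (vx 3)) = X 2 ^ 2 - X 3 * X 1 := by
  rw [rho_ff]; simp [rho, vx]; ring
theorem rho3 : rho K (ff (vx 3) (vx 4)) = X 3 ^ 2 := by
  rw [rho_ff]; simp [rho, vx]; ring
theorem rho4 : rho K (ff (vx 4) (vx 5)) = 0 := by
  rw [rho_ff]; simp [rho, vx]
theorem rho5 : rho K (ff (vx 0) (vx 5)) = 0 := by
  rw [rho_ff]; simp [rho, vx]

theorem rho_J : Ideal.map (rho K) (JJ K) ≤ 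
    (Ideal.span {X 0 ^ 2} ⊔ (Ideal.span {X 1 ^ 2 - X 2 * X 0} ⊔ Ideal.span {X 2 ^ 2 - X 3 * X 1} ⊔ Ideal.span {X 3 ^ 2}) :
      Ideal (MvPolynomial (Fin 4) K)) := by
  rw [Ideal.map_le_iff_le_comap]
  refine sup_le ?_ ?_
  · rw [bb, bb, bb, bb, bb, bb]
    simp only [bot_sup_eq, sup_le_iff, Ideal.span_singleton_le_iff_mem, Ideal.mem_comap]
    refine ⟨⟨⟨⟨?_, ?_⟩, ?_⟩, ?_⟩, ?_⟩
    · rw [fe, ff_symm, map_neg, rho0]; exact neg_mem (Submodule.mem_sup_left (Ideal.mem_span_singleton_self _))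
    · rw [fe, ff_symm, map_neg, rho1]
      exact neg_mem (Submodule.mem_sup_right (Submodule.mem_sup_left (Submodule.mem_sup_left (Ideal.mem_span_singleton_self _))))
    · rw [fe, ff_symm, map_neg, rho2]
      exact neg_mem (Submodule.mem_sup_right (Submodule.mem_sup_left (Submodule.mem_sup_right (Ideal.mem_span_singleton_self _))))
    · rw [fe, ff_symm, map_neg, rho3]
      exact neg_mem (Submodule.mem_sup_right (Submodule.mem_sup_right (Ideal.mem_span_singleton_self _)))
    · rw [fe, ff_symm, map_neg, rho4, neg_zero]; exact zero_mem _
  · rw [Ideal.span_singleton_le_iff_mem, Ideal.mem_comap, gg, rho5]; exact zero_mem _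

end

end C6

namespace C6
universe u
set_option linter.unusedSectionVars false
set_option linter.unusedVariables false
open ZG

section
variable {K : Type u} [Field K] {I : Ideal (MvPolynomial (Fin 6 ⊕ Fin 6) K)}

local notation "S12" => MvPolynomial (Fin 6 ⊕ Fin 6) K

noncomputable def dd (F : GradedFreeResolution I) (i : ℕ) : (Fin (F.rk (i+1)) → S12) →ₗ[S12] (Fin (F.rk i) → S12) :=
  Matrix.mulVecLin (Matrix.of (F.mat i))

theorem dd_apply (F : GradedFreeResolution I) (i : ℕ) (w) (r) : dd F i w r = ∑ c, F.mat i r c * w c := rfl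

noncomputable def ddR (F : GradedFreeResolution I) (i : ℕ) :
    (Fin (F.rk (i+1)) → MvPolynomial (Fin 4) K) →ₗ[MvPolynomial (Fin 4) K] (Fin (F.rk i) → MvPolynomial (Fin 4) K) :=
  Matrix.mulVecLin (Matrix.of (fun r c => rho K (F.mat i r c)))

theorem ddR_apply (F : GradedFreeResolution I) (i : ℕ) (w) (r) : ddR F i w r = ∑ c, rho K (F.mat i r c) * w c := rfl

theorem rho_dd (F : GradedFreeResolution I) (i : ℕ) (w : Fin (F.rk (i+1)) → S12) : 
    ddR F i (fun c => rho K (w c)) = fun r => rho K (dd F i w r) := by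
  funext r
  rw [ddR_apply, dd_apply, map_sum]
  simp only [map_mul]

theorem dd_comp (F : GradedFreeResolution I) (i : ℕ) (w) : dd F i (dd F (i+1) w) = 0 :=
  funext ((F.exact_succ i _).2 ⟨w, fun c => rfl⟩)

theorem dd_exact (F : GradedFreeResolution I) (i : ℕ) (v) (h : dd F i v = 0) : ∃ w, v = dd F (i+1) w := by
  obtain ⟨w, hw⟩ := (F.exact_succ i v).1 (fun r => congrFun h r)
  exact ⟨w, funext hw⟩

theorem ddR_comp (F : GradedFreeResolution I) (i : ℕ) (w) : ddR F i (ddR F (i+1) w) = 0 := by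
  have h : Matrix.of (fun r c => rho K (F.mat i r c)) * Matrix.of (fun r c => rho K (F.mat (i+1) r c)) = 0 := by
    ext1 r c
    have := dd_comp F i (Pi.single c 1)
    have := congrArg (rho K) (congrFun this r)
    rw [dd_apply] at this
    simp only [dd_apply, Pi.single_apply, mul_ite, mul_one, mul_zero, Finset.sum_ite_eq', Finset.sum_ite_eq, Finset.mem_univ, if_true, map_sum, map_mul, Pi.zero_apply, map_zero] at this
    simpa [Matrix.mul_apply] using this
  simp only [ddR, Matrix.mulVecLin_apply, Matrix.mulVec_mulVec]
  rw [h, Matrix.zero_mulVec]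

theorem mat_hd (F : GradedFreeResolution I) (i : ℕ) (r c) : F.mat i r c ∈ hd ((F.tw (i+1) c : ℤ) - F.tw i r) := by
  have := F.mat_homog i r c
  split_ifs at this with h
  · have := hd_nat.2 this
    push_cast [h] at this
    exact this
  · rw [this]; exact zero_mem _

def HV (F : GradedFreeResolution I) (i : ℕ) (d : ℤ) (v : Fin (F.rk i) → S12) : Prop := ∀ r, v r ∈ hd (d - F.tw i r)

theorem HV.smul {F : GradedFreeResolution I} {i : ℕ} {d : ℤ} {v} (h : HV F i d v) {f : S12} {k : ℤ} (hf : f ∈ hd k) :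
    HV F i (d + k) (f • v) := by
  intro r
  have := hd_mul hf (h r)
  rw [show k + (d - F.tw i r) = d + k - F.tw i r by ring] at this
  exact this

theorem HV.add {F : GradedFreeResolution I} {i : ℕ} {d : ℤ} {v w} (h : HV F i d v) (h' : HV F i d w) :
    HV F i d (v + w) := fun r => add_mem (h r) (h' r)

theorem HV.sub {F : GradedFreeResolution I} {i : ℕ} {d : ℤ} {v w} (h : HV F i d v) (h' : HV F i d w) :
    HV F i d (v - w) := fun r => sub_mem (h r) (h' r)

theorem lift_hom (F : GradedFreeResolution I) (i : ℕ) {d : ℤ} {v} (hv : HV F i d v) (h : ∃ w, v = dd F i w) :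
    ∃ w, HV F (i+1) d w ∧ dd F i w = v := by
  obtain ⟨w, hw⟩ := h
  refine ⟨fun c => cmp (d - F.tw (i+1) c) (w c), fun c => cmp_mem _ _, ?_⟩
  funext r
  rw [← cmp_self (hv r), hw, dd_apply, dd_apply, map_sum]
  refine Finset.sum_congr rfl fun c _ => ?_
  rw [cmp_mul (mat_hd F i r c)]
  congr 2
  ring

theorem lift_zero (F : GradedFreeResolution I) (hI : IsH I) {k : ℤ} {f : S12} (hf : f ∈ hd k) :
    ∃ p, HV F 0 k p ∧ f - ∑ r, F.aug r * p r ∈ I := by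
  obtain ⟨v, hv⟩ := F.aug_surj f
  refine ⟨fun c => cmp (k - F.tw 0 c) (v c), fun c => cmp_mem _ _, ?_⟩
  have := hI.cmp hv k
  rw [map_sub, cmp_self hf, map_sum] at this
  convert this using 3 with r
  rw [cmp_mul (hd_nat.2 (F.aug_homog r))]

theorem lower (s : ℕ) (F : GradedFreeResolution (JJ K ^ (s+1))) (htw : ∀ r, F.tw 4 r < 2 * s + 8) : False := by
  have hI : IsH (JJ K ^ (s+1)) := JJ_isH.pow _
  set f : Fin 4 → S12 := fun i => ff (vx i) (vx (i+1)) with hf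
  have fhd : ∀ i, f i ∈ hd 2 := fun i => ff_hd _ _
  have fJ : ∀ i, f i ∈ JJ K := by
    intro i
    have : f i = - fe K i := by rw [hf, fe]; exact ff_symm _ _
    rw [this]
    exact neg_mem (fe_mem (by omega))
  have f0s : f 0 ^ s ∈ hd (2 * (s : ℤ)) := by
    have : (f 0 ^ s).IsHomogeneous (2 * s) := ((hd_nat (n := 2)).1 (fhd 0)).pow _
    have h2 := (hd_nat (n := 2 * s)).2 this
    simpa using h2
  obtain ⟨p0, hp0, ep0⟩ := lift_zero F hI f0s
  have ex1 : ∀ i, ∃ w, HV F 1 (2 * s + 2) w ∧ dd F 0 w = f i • p0 := by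
    intro i
    apply lift_hom F 0 (hp0.smul (fhd i))
    have : ∑ r, F.aug r * (f i • p0) r ∈ JJ K ^ (s+1) := by
      have e : ∑ r, F.aug r * (f i • p0) r = f i * f 0 ^ s - f i * (f 0 ^ s - ∑ r, F.aug r * p0 r) := by
        rw [mul_sub, sub_sub_cancel, Finset.mul_sum]
        refine Finset.sum_congr rfl fun r _ => ?_
        rw [Pi.smul_apply, smul_eq_mul]; ring
      rw [e]
      refine sub_mem ?_ (Ideal.mul_mem_left _ _ ep0)
      rw [pow_succ']
      exact Ideal.mul_mem_mul (fJ i) (Ideal.pow_mem_pow (fJ 0) _)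
    obtain ⟨w, hw⟩ := (F.exact_zero _).1 this
    exact ⟨w, funext hw⟩
  choose p1 hp1 ep1 using ex1
  have ex2 : ∀ i j, ∃ w, HV F 2 (2 * s + 2 + 2) w ∧ dd F 1 w = f i • p1 j - f j • p1 i := by
    intro i j
    apply lift_hom F 1 (((hp1 j).smul (fhd i)).sub ((hp1 i).smul (fhd j)))
    apply dd_exact F 0
    simp only [map_sub, map_smul, ep1]
    module
  choose p2 hp2 ep2 using ex2
  have ex3 : ∀ i j k, ∃ w, HV F 3 (2 * s + 2 + 2 + 2) w ∧ dd F 2 w = f i • p2 j k - f j • p2 i k + f k • p2 i j := by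
    intro i j k
    apply lift_hom F 2 ((((hp2 j k).smul (fhd i)).sub ((hp2 i k).smul (fhd j))).add ((hp2 i j).smul (fhd k)))
    apply dd_exact F 1
    simp only [map_sub, map_add, map_smul, ep2]
    module
  choose p3 hp3 ep3 using ex3
  have ex4 : ∃ w, HV F 4 (2 * s + 2 + 2 + 2 + 2) w ∧ dd F 3 w = f 0 • p3 1 2 3 - f 1 • p3 0 2 3 + f 2 • p3 0 1 3 - f 3 • p3 0 1 2 := by
    apply lift_hom F 3 (((((hp3 1 2 3).smul (fhd 0)).sub ((hp3 0 2 3).smul (fhd 1))).add ((hp3 0 1 3).smul (fhd 2))).sub ((hp3 0 1 2).smul (fhd 3)))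
    apply dd_exact F 2
    simp only [map_sub, map_add, map_smul, ep3]
    module
  obtain ⟨p4, hp4, ep4⟩ := ex4
  have r0 : rho K (f 0) = X 0 ^ 2 := rho0
  have r1 : rho K (f 1) = X 1 ^ 2 - X 2 * X 0 := rho1
  have r2 : rho K (f 2) = X 2 ^ 2 - X 3 * X 1 := rho2
  have r3 : rho K (f 3) = X 3 ^ 2 := rho3
  obtain ⟨w, hw⟩ := chase (ddR F 0) (ddR F 1) (ddR F 2) (ddR F 3) (ddR_comp F 0) (ddR_comp F 1) (ddR_comp F 2) rfl rfl rfl rfl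
    (fun r => rho K (p0 r)) (fun r => rho K (p1 0 r)) (fun r => rho K (p1 1 r)) (fun r => rho K (p2 0 1 r)) (fun r => rho K (p2 0 2 r))
    (fun r => rho K (p2 1 2 r)) (fun r => rho K (p3 0 1 2 r)) (fun r => rho K (p3 0 1 3 r)) (fun r => rho K (p3 0 2 3 r)) (fun r => rho K (p3 1 2 3 r))
    (fun r => rho K (p4 r)) 
    (by rw [rho_dd, ep1]; funext r; simp [r0])
    (by rw [rho_dd, ep2]; funext r; simp [r0, r1])
    (by rw [rho_dd, ep3]; funext r; simp [r0, r1, r2])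
    (by rw [rho_dd, ep4]; funext r; simp [r0, r1, r2, r3])
    (by
      intro r
      rw [rho_const]
      by_contra hne
      have h1 := mem_hd.1 (hp4 r) 0 hne
      have h2 := htw r
      simp at h1
      omega)
  -- conclusion
  have hmem : X 0 ^ (2 * s) * (X 0 * X 1 * X 2 * X 3) ∈ Ideal.map (rho K) (JJ K ^ (s+1)) := by
    have c1 : ∑ r, rho K (F.aug r) * (ddR F 0 w r) ∈ Ideal.map (rho K) (JJ K ^ (s+1)) := by
      have e : ∑ r, rho K (F.aug r) * (ddR F 0 w r) = ∑ c, rho K (∑ r, F.aug r * F.mat 0 r c) * w c := by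
        simp only [ddR_apply, Finset.mul_sum, map_sum, Finset.sum_mul, map_mul]
        rw [Finset.sum_comm]
        simp only [mul_assoc]
      rw [e]
      refine sum_mem fun c _ => Ideal.mul_mem_right _ _ (Ideal.mem_map_of_mem _ ?_)
      refine (F.exact_zero _).2 ⟨Pi.single c 1, fun r => ?_⟩
      simp [Pi.single_apply]
    have c2 := Ideal.mem_map_of_mem (rho K) ep0
    rw [hw] at c1
    have e : X 0 ^ (2 * s) * (X 0 * X 1 * X 2 * X 3) = (X 0 * X 1 * X 2 * X 3) * rho K (f 0 ^ s - ∑ r, F.aug r * p0 r)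
        + ∑ r, rho K (F.aug r) * (((X 0 * X 1 * X 2 * X 3 : MvPolynomial (Fin 4) K) • fun r => rho K (p0 r)) r) := by
      have e1 : ∑ r, rho K (F.aug r) * (((X 0 * X 1 * X 2 * X 3 : MvPolynomial (Fin 4) K) • fun r => rho K (p0 r)) r) =
          (X 0 * X 1 * X 2 * X 3) * rho K (∑ r, F.aug r * p0 r) := by
        rw [map_sum, Finset.mul_sum]
        refine Finset.sum_congr rfl fun r _ => ?_
        rw [Pi.smul_apply, smul_eq_mul, map_mul]; ring
      rw [e1, map_sub, map_pow, r0, ← pow_mul]; ring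
    rw [e]
    exact add_mem (Ideal.mul_mem_left _ _ c2) c1
  rw [Ideal.map_pow] at hmem
  exact not_mem s (Ideal.pow_right_mono rho_J _ hmem)

theorem lower_of_eq (s : ℕ) (J : Ideal S12) (hJ : J = JJ K ^ (s+1)) (F : GradedFreeResolution J)
    (htw : ∀ r, F.tw 4 r < 2 * s + 8) : False := by
  subst hJ
  exact lower s F htw

theorem reg_final (s : ℕ) : quotRegularity K (binomialEdgeIdeal K (SimpleGraph.cycleGraph 6) ^ (s+1)) = 2 * s + 4 := by
  unfold quotRegularity
  apply le_antisymm
  · exact Nat.sInf_le (upper_final (K := K) s)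
  · refine le_csInf ?_ ?_
    · exact ⟨_, upper_final (K := K) s⟩
    rintro m ⟨F, hF⟩
    by_contra hlt
    refine lower_of_eq s _ (by rw [JJ_eq]) F fun r => ?_
    have := hF 4 r
    omega
end

end C6

theorem reg_binomialEdgeIdeal_C6 (K : Type*) [Field K] :
    quotRegularity K (binomialEdgeIdeal K (SimpleGraph.cycleGraph 6)) = 4 ∧
    ∀ t : ℕ, 2 ≤ t →
      quotRegularity K ((binomialEdgeIdeal K (SimpleGraph.cycleGraph 6)) ^ t)
        = 2 * t + 2 := by
  refine ⟨?_, fun t ht => ?_⟩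
  · have h := C6.reg_final (K := K) 0
    rwa [zero_add, pow_one] at h
  · obtain ⟨s, rfl⟩ : ∃ s, t = s + 1 := ⟨t - 1, by omega⟩
    rw [C6.reg_final]
    ring
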